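/- arXiv:2102.05777 — 2 statements merged into one kernel-verified Lean document; each statement's English description precedes it below -/
import Mathlib

section
/- There exist universal constants C₃, C₄, C₅ such that for every finite set E ⊂ ℝ² with #E = N there exists a list of subsets S₁, S₂, …, S_L ⊆ E satisfying: (i) #S_ℓ ≤ C₃ for each ℓ = 1, …, L; (ii) L ≤ C₄·N; (iii) for every f : E → [0,∞), max_{ℓ=1,…,L} ‖f‖_{C²₊(S_ℓ)} ≤ ‖f‖_{C²₊(E)} ≤ C₅ · max_{ℓ=1,…,L} ‖f‖_{C²₊(S_ℓ)}. -/
/-- The plane `ℝ²`. -/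
abbrev E2 := EuclideanSpace ℝ (Fin 2)

/-- `F` is twice continuously differentiable with all derivatives of order `≤ 2`
bounded (in norm) by `M`; this encodes `‖F‖_{C²(ℝ²)} ≤ M`. -/
def C2BddBy (F : E2 → ℝ) (M : ℝ) : Prop :=
  ContDiff ℝ 2 F ∧ ∀ x : E2, ∀ i : ℕ, i ≤ 2 → ‖iteratedFDeriv ℝ i F x‖ ≤ M

/-- The trace norm `‖f‖_{C²₊(S)}`. -/
noncomputable def posTraceNorm (S : Set E2) (f : E2 → ℝ) : ℝ :=
  sInf {M : ℝ | 0 ≤ M ∧ ∃ F : E2 → ℝ,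
    (∀ y, 0 ≤ F y) ∧ (∀ x ∈ S, F x = f x) ∧ C2BddBy F M}

namespace C2BddBy

variable {F G : E2 → ℝ} {M M' : ℝ}

theorem nonneg (h : C2BddBy F M) : 0 ≤ M :=
  (norm_nonneg _).trans (h.2 0 0 (by norm_num))

theorem mono (h : C2BddBy F M) (hM : M ≤ M') : C2BddBy F M' :=
  ⟨h.1, fun x i hi => (h.2 x i hi).trans hM⟩

theorem abs_le (h : C2BddBy F M) (x : E2) : |F x| ≤ M := by
  simpa using h.2 x 0 (by norm_num)

theorem differentiable (h : C2BddBy F M) : Differentiable ℝ F :=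
  h.1.differentiable (by norm_num)

theorem inner_gradient (F : E2 → ℝ) (x v : E2) : inner ℝ (gradient F x) v = fderiv ℝ F x v := by
  simp [gradient]

theorem norm_gradient_le (h : C2BddBy F M) (x : E2) : ‖gradient F x‖ ≤ M := by
  have := h.2 x 1 (by norm_num)
  rw [norm_iteratedFDeriv_one] at this
  simpa [gradient] using this

theorem norm_fderiv_sub_le (h : C2BddBy F M) (x y : E2) :
    ‖fderiv ℝ F x - fderiv ℝ F y‖ ≤ M * ‖x - y‖ := by
  have hd : Differentiable ℝ (fderiv ℝ F) :=
    (h.1.fderiv_right (m := 1) (by norm_num)).differentiable (by norm_num)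
  refine Convex.norm_image_sub_le_of_norm_fderiv_le (𝕜 := ℝ) (s := Set.univ)
    (fun z _ => hd z) (fun z _ => ?_) convex_univ (Set.mem_univ y) (Set.mem_univ x)
  have := h.2 z 2 le_rfl
  rwa [← norm_iteratedFDeriv_fderiv, norm_iteratedFDeriv_one] at this

theorem norm_gradient_sub_le (h : C2BddBy F M) (x y : E2) :
    ‖gradient F x - gradient F y‖ ≤ M * ‖x - y‖ := by
  rw [gradient, gradient, ← map_sub, LinearIsometryEquiv.norm_map]
  exact h.norm_fderiv_sub_le x y

theorem taylor (h : C2BddBy F M) (x y : E2) :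
    |F y - F x - inner ℝ (gradient F x) (y - x)| ≤ M * ‖y - x‖ ^ 2 := by
  rw [inner_gradient, pow_two, ← mul_assoc, ← Real.norm_eq_abs]
  refine Convex.norm_image_sub_le_of_norm_fderiv_le' (𝕜 := ℝ) (s := segment ℝ x y)
    (fun z _ => h.differentiable z) (fun z hz => ?_) (convex_segment x y)
    (left_mem_segment ℝ x y) (right_mem_segment ℝ x y)
  refine (h.norm_fderiv_sub_le z x).trans (mul_le_mul_of_nonneg_left ?_ h.nonneg)
  obtain ⟨t, ht, rfl⟩ := (segment_eq_image' ℝ x y) ▸ hz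
  rw [add_sub_cancel_left, norm_smul, Real.norm_of_nonneg ht.1]
  exact mul_le_of_le_one_left (norm_nonneg _) ht.2

theorem abs_inner_gradient_le_of_eq (h : C2BddBy F M) {x y : E2} (hxy : F x = F y) :
    |inner ℝ (gradient F x) (y - x)| ≤ M * ‖y - x‖ ^ 2 := by
  have := h.taylor x y
  rwa [hxy, sub_self, zero_sub, abs_neg] at this

theorem abs_inner_gradient_sub_le_of_eq (hF : C2BddBy F M) (hG : C2BddBy G M) {x y : E2}
    (hx : F x = G x) (hy : F y = G y) :
    |inner ℝ (gradient F x - gradient G x) (y - x)| ≤ 2 * M * ‖y - x‖ ^ 2 := by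
  have h1 := _root_.abs_le.1 (hF.taylor x y)
  have h2 := _root_.abs_le.1 (hG.taylor x y)
  rw [hx, hy] at h1
  rw [inner_sub_left]
  exact _root_.abs_le.2 ⟨by linarith, by linarith⟩

theorem sub (hF : C2BddBy F M) (hG : C2BddBy G M') :
    C2BddBy (fun x => F x - G x) (M + M') := by
  refine ⟨hF.1.sub hG.1, fun x i hi => ?_⟩
  have hi' : ((i : ℕ) : WithTop ℕ∞) ≤ 2 := by exact_mod_cast hi
  have e : (fun x => F x - G x) = F - G := rfl
  rw [e, iteratedFDeriv_sub_apply (hF.1.of_le hi').contDiffAt (hG.1.of_le hi').contDiffAt]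
  exact (norm_sub_le _ _).trans (add_le_add (hF.2 x i hi) (hG.2 x i hi))

theorem const_mul (hF : C2BddBy F M) (c : ℝ) : C2BddBy (fun x => c * F x) (|c| * M) := by
  refine ⟨contDiff_const.mul hF.1, fun x i hi => ?_⟩
  have hi' : ((i : ℕ) : WithTop ℕ∞) ≤ 2 := by exact_mod_cast hi
  have := iteratedFDeriv_const_smul_apply (𝕜 := ℝ) (i := i) (f := F) (a := c) (x := x)
    ((hF.1.of_le hi').contDiffAt)
  have e : (fun x => c * F x) = c • F := rfl
  rw [e, this, norm_smul, Real.norm_eq_abs]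
  exact mul_le_mul_of_nonneg_left (hF.2 x i hi) (abs_nonneg c)

theorem gradient_const_mul_sub (hF : C2BddBy F M) (hG : C2BddBy G M') (c : ℝ) (x : E2) :
    gradient (fun x => c * (F x - G x)) x = c • (gradient F x - gradient G x) := by
  have := ((hF.differentiable x).hasFDerivAt.fun_sub (hG.differentiable x).hasFDerivAt).const_mul c
  simp [gradient, this.fderiv]

theorem zero : C2BddBy (fun _ => 0) 0 := by
  refine ⟨contDiff_const, fun x i _ => ?_⟩
  simp

theorem norm_gradient_sq_le (h : C2BddBy F M) (hF : ∀ y, 0 ≤ F y) (x : E2) :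
    ‖gradient F x‖ ^ 2 ≤ 4 * M * F x := by
  rcases h.nonneg.eq_or_lt with h0 | h0
  · have := h.norm_gradient_le x
    rw [← h0] at this ⊢
    have := le_antisymm this (norm_nonneg _)
    rw [this]; simp
  · have h1 := (abs_le'.1 (h.taylor x (x - (1 / (2 * M)) • gradient F x))).1
    have h2 := hF (x - (1 / (2 * M)) • gradient F x)
    rw [sub_sub_cancel_left, inner_neg_right, inner_smul_right, real_inner_self_eq_norm_sq,
      norm_neg, norm_smul, Real.norm_of_nonneg (by positivity)] at h1
    have e : M * (1 / (2 * M) * ‖gradient F x‖) ^ 2 = ‖gradient F x‖ ^ 2 / (4 * M) := by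
      field_simp; ring
    have e2 : 1 / (2 * M) * ‖gradient F x‖ ^ 2 = 2 * (‖gradient F x‖ ^ 2 / (4 * M)) := by
      field_simp; ring
    rw [e, e2] at h1
    have : ‖gradient F x‖ ^ 2 / (4 * M) ≤ F x := by linarith
    rw [div_le_iff₀ (by positivity)] at this
    linarith

theorem norm_gradient_le_sqrt (h : C2BddBy F M) (hF : ∀ y, 0 ≤ F y) (x : E2) :
    ‖gradient F x‖ ≤ 2 * √(M * F x) := by
  have := h.norm_gradient_sq_le hF x
  rw [← Real.sqrt_le_sqrt_iff (by positivity [h.nonneg, hF x]), Real.sqrt_sq (norm_nonneg _)] at this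
  refine this.trans (le_of_eq ?_)
  rw [mul_assoc, Real.sqrt_mul (by norm_num)]
  congr 1
  rw [show (4 : ℝ) = 2 ^ 2 by norm_num]; exact Real.sqrt_sq (by norm_num)

theorem sqrt_le (h : C2BddBy F M) (hF : ∀ y, 0 ≤ F y) (x y : E2) :
    √(M * F y) ≤ √(M * F x) + M * ‖y - x‖ := by
  have h1 := (abs_le'.1 (h.taylor x y)).1
  have h2 := (real_inner_le_norm (gradient F x) (y - x)).trans
    (mul_le_mul_of_nonneg_right (h.norm_gradient_le_sqrt hF x) (norm_nonneg _))
  have hM := h.nonneg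
  have h3 := Real.sq_sqrt (mul_nonneg hM (hF x))
  refine Real.sqrt_le_iff.2 ⟨by positivity, ?_⟩
  nlinarith [mul_le_mul_of_nonneg_left (show F y ≤ F x + 2 * √(M * F x) * ‖y - x‖ +
    M * ‖y - x‖ ^ 2 by linarith) hM]

end C2BddBy

theorem norm_sub_le_of_directions_close {v w : E2} (hvw : ‖v‖ ≤ ‖w‖)
    (h : ‖(‖w‖⁻¹ • w) - (‖v‖⁻¹ • v)‖ ≤ 1 / 4) : ‖w - v‖ ≤ ‖w‖ - 3 / 4 * ‖v‖ := by
  rcases eq_or_ne v 0 with rfl | hv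
  · simp
  have hv' := norm_pos_iff.2 hv
  have hw' := hv'.trans_le hvw
  have e : w - v = (‖w‖ - ‖v‖) • (‖w‖⁻¹ • w) + ‖v‖ • ((‖w‖⁻¹ • w) - (‖v‖⁻¹ • v)) := by
    rw [smul_sub, smul_inv_smul₀ hv'.ne', sub_smul, smul_inv_smul₀ hw'.ne']
    abel
  rw [e]
  refine (norm_add_le _ _).trans ?_
  rw [norm_smul, norm_smul _ w, norm_smul, norm_inv, norm_norm,
    inv_mul_cancel₀ hw'.ne', Real.norm_of_nonneg (sub_nonneg.2 hvw), norm_norm]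
  nlinarith

/-- In the directed graph `T`, every point of `A` can be approached from every other one. -/
def Approaches (T : Finset (E2 × E2)) (A : Finset E2) : Prop :=
  ∀ x ∈ A, ∀ y ∈ A, x ≠ y →
      ∃ z ∈ A, (x, z) ∈ T ∧ z ≠ x ∧ ‖z - x‖ ≤ ‖y - x‖ ∧
        ‖y - z‖ ≤ ‖y - x‖ - 3 / 4 * ‖z - x‖

/-- Yao graphs: a finite planar set has a directed graph with linearly many edges in which
every point can be approached from every other one. -/
theorem exists_yao_graph : ∃ k : ℕ, ∀ A : Finset E2, ∃ T : Finset (E2 × E2),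
    T ⊆ A ×ˢ A ∧ T.card ≤ k * A.card ∧ Approaches T A := by
  classical
  obtain ⟨t, -, htf, ht⟩ := (isCompact_sphere (0 : E2) 1).finite_cover_balls
    (show (0 : ℝ) < 1 / 8 by norm_num)
  refine ⟨htf.toFinset.card, fun A => ?_⟩
  let cone : E2 → E2 → Finset E2 := fun x c =>
    A.filter fun y => y ≠ x ∧ ‖(‖y - x‖⁻¹ • (y - x)) - c‖ < 1 / 8
  have key : ∀ x c, ∃ z, x ∈ A → z ∈ A ∧
      ∀ y ∈ cone x c, z ∈ cone x c ∧ ‖z - x‖ ≤ ‖y - x‖ := by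
    intro x c
    by_cases h : (cone x c).Nonempty
    · obtain ⟨z, hz, hz'⟩ := (cone x c).exists_min_image (fun z => ‖z - x‖) h
      exact ⟨z, fun _ => ⟨(Finset.mem_filter.1 hz).1, fun y hy => ⟨hz, hz' y hy⟩⟩⟩
    · rw [Finset.not_nonempty_iff_eq_empty] at h
      exact ⟨x, fun hx => ⟨hx, by simp [h]⟩⟩
  choose z hz using key
  refine ⟨(A ×ˢ htf.toFinset).image fun q => (q.1, z q.1 q.2), ?_, ?_, ?_⟩
  · intro q hq
    obtain ⟨⟨x, c⟩, hxc, rfl⟩ := Finset.mem_image.1 hq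
    have hx := (Finset.mem_product.1 hxc).1
    exact Finset.mem_product.2 ⟨hx, (hz x c hx).1⟩
  · refine Finset.card_image_le.trans ?_
    rw [Finset.card_product, mul_comm]
  · intro x hx y hy hxy
    have hyx : y - x ≠ 0 := sub_ne_zero.2 hxy.symm
    have hs : ‖y - x‖⁻¹ • (y - x) ∈ Metric.sphere (0 : E2) 1 := by
      simp [norm_smul, hyx]
    obtain ⟨c, hc, hyc⟩ := Set.mem_iUnion₂.1 (ht hs)
    rw [Metric.mem_ball, dist_eq_norm] at hyc
    obtain ⟨hzA, hzc⟩ := hz x c hx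
    obtain ⟨hzc, hle⟩ := hzc y (Finset.mem_filter.2 ⟨hy, hxy.symm, hyc⟩)
    obtain ⟨-, hzx, hzc⟩ := Finset.mem_filter.1 hzc
    refine ⟨z x c, hzA, Finset.mem_image.2 ⟨(x, c), by simp [hx, hc], rfl⟩, hzx, hle, ?_⟩
    rw [← sub_sub_sub_cancel_right y (z x c) x]
    refine norm_sub_le_of_directions_close hle ?_
    rw [← sub_sub_sub_cancel_right _ _ c]
    exact (norm_sub_le _ _).trans (by linarith)

namespace Approaches

variable {T : Finset (E2 × E2)} {A : Finset E2}

theorem induction (hT : Approaches T A) {y : E2} (hy : y ∈ A) {P : E2 → Prop} (h0 : P y)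
    (h : ∀ x ∈ A, ∀ z ∈ A, (x, z) ∈ T → ‖z - x‖ ≤ ‖y - x‖ →
      ‖y - z‖ ≤ ‖y - x‖ - 3 / 4 * ‖z - x‖ → P z → P x) : ∀ x ∈ A, P x := by
  classical
  by_contra! hc
  obtain ⟨w, hw, hPw⟩ := hc
  obtain ⟨x, hx, hmin⟩ := (A.filter fun x => ¬ P x).exists_min_image (fun x => ‖y - x‖)
    ⟨w, by simp [hw, hPw]⟩
  obtain ⟨hxA, hPx⟩ := Finset.mem_filter.1 hx
  have hxy : x ≠ y := fun e => hPx (e ▸ h0)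
  obtain ⟨z, hz, hxz, hzx, h1, h2⟩ := hT x hxA y hy hxy
  refine hPx (h x hxA z hz hxz h1 h2 ?_)
  by_contra hPz
  have := hmin z (Finset.mem_filter.2 ⟨hz, hPz⟩)
  have : 0 < ‖z - x‖ := norm_pos_iff.2 (sub_ne_zero.2 hzx)
  linarith

theorem norm_sub_le {X : Type*} [SeminormedAddCommGroup X] (hT : Approaches T A)
    {h : E2 → X} {K : ℝ} (hK : 0 ≤ K) (hh : ∀ x y, (x, y) ∈ T → ‖h y - h x‖ ≤ K * ‖y - x‖)
    {x y : E2} (hx : x ∈ A) (hy : y ∈ A) : ‖h y - h x‖ ≤ 2 * K * ‖y - x‖ := by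
  refine hT.induction hy (P := fun x => ‖h y - h x‖ ≤ 2 * K * ‖y - x‖) (by simp)
    (fun x _ z _ hxz _ h2 ih => ?_) x hx
  have h3 := norm_add_le (h y - h z) (h z - h x)
  rw [sub_add_sub_cancel] at h3
  have := hh x z hxz
  nlinarith [mul_le_mul_of_nonneg_left h2 hK, mul_nonneg hK (norm_nonneg (z - x))]

theorem taylor (hT : Approaches T A) {f : E2 → ℝ} {g : E2 → E2} {K : ℝ} (hK : 0 ≤ K)
    (hg : ∀ x ∈ A, ∀ y ∈ A, ‖g y - g x‖ ≤ K * ‖y - x‖)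
    (hf : ∀ x y, (x, y) ∈ T → |f y - f x - inner ℝ (g x) (y - x)| ≤ K * ‖y - x‖ ^ 2)
    {x y : E2} (hx : x ∈ A) (hy : y ∈ A) :
    |f y - f x - inner ℝ (g x) (y - x)| ≤ 4 * K * ‖y - x‖ ^ 2 := by
  refine hT.induction hy (P := fun x => |f y - f x - inner ℝ (g x) (y - x)| ≤
    4 * K * ‖y - x‖ ^ 2) (by simp) (fun x hx z hz hxz h1 h2 ih => ?_) x hx
  have e : f y - f x - inner ℝ (g x) (y - x) = (f z - f x - inner ℝ (g x) (z - x)) +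
      (f y - f z - inner ℝ (g z) (y - z)) + inner ℝ (g z - g x) (y - z) := by
    rw [inner_sub_left, ← sub_add_sub_cancel y z x, inner_add_right]; ring
  have h3 := (abs_real_inner_le_norm (g z - g x) (y - z)).trans
    (mul_le_mul_of_nonneg_right (hg x hx z hz) (norm_nonneg _))
  rw [e]
  refine (abs_add_three _ _ _).trans ((add_le_add (add_le_add (hf x z hxz) ih) h3).trans ?_)
  set a := ‖z - x‖
  set b := ‖y - z‖
  set d := ‖y - x‖
  have ha : 0 ≤ a := norm_nonneg _
  have hb : 0 ≤ b := norm_nonneg _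
  have : a ^ 2 + 4 * b ^ 2 + a * b ≤ 4 * d ^ 2 := by
    nlinarith [mul_nonneg ha hb]
  nlinarith [mul_le_mul_of_nonneg_left this hK]

end Approaches

/-- The largest gradient at `p` of a function of `C²` norm at most `1` vanishing on `S`. -/
noncomputable def gradientFreedom (S : Finset E2) (p : E2) : ℝ :=
  sSup {r : ℝ | ∃ G : E2 → ℝ, C2BddBy G 1 ∧ (∀ x ∈ S, G x = 0) ∧ ‖gradient G p‖ = r}

theorem bddAbove_gradientFreedom (S : Finset E2) (p : E2) :
    BddAbove {r : ℝ | ∃ G : E2 → ℝ, C2BddBy G 1 ∧ (∀ x ∈ S, G x = 0) ∧ ‖gradient G p‖ = r} := by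
  refine ⟨1, ?_⟩
  rintro r ⟨G, hG, -, rfl⟩
  exact hG.norm_gradient_le p

theorem nonempty_gradientFreedom (S : Finset E2) (p : E2) :
    {r : ℝ | ∃ G : E2 → ℝ,
      C2BddBy G 1 ∧ (∀ x ∈ S, G x = 0) ∧ ‖gradient G p‖ = r}.Nonempty :=
  ⟨_, _, C2BddBy.zero.mono zero_le_one, fun _ _ => rfl, rfl⟩

theorem norm_gradient_le_gradientFreedom {S : Finset E2} {G : E2 → ℝ} (hG : C2BddBy G 1)
    (hS : ∀ x ∈ S, G x = 0) (p : E2) : ‖gradient G p‖ ≤ gradientFreedom S p :=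
  le_csSup (bddAbove_gradientFreedom S p) ⟨G, hG, hS, rfl⟩

theorem gradientFreedom_nonneg (S : Finset E2) (p : E2) : 0 ≤ gradientFreedom S p :=
  (norm_nonneg _).trans (norm_gradient_le_gradientFreedom
    (C2BddBy.zero.mono zero_le_one) (fun _ _ => rfl) p)

theorem gradientFreedom_le_add (S : Finset E2) (p q : E2) :
    gradientFreedom S q ≤ gradientFreedom S p + ‖q - p‖ := by
  refine csSup_le (nonempty_gradientFreedom S q) ?_
  rintro r ⟨G, hG, hS, rfl⟩
  have h1 := hG.norm_gradient_sub_le q p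
  have h2 := norm_gradient_le_gradientFreedom hG hS p
  have h3 := norm_add_le (gradient G q - gradient G p) (gradient G p)
  rw [sub_add_cancel] at h3
  linarith

theorem norm_gradient_sub_le_gradientFreedom {S : Finset E2} {F G : E2 → ℝ} {M : ℝ}
    (hF : C2BddBy F M) (hG : C2BddBy G M) (hS : ∀ x ∈ S, F x = G x) (p : E2) :
    ‖gradient F p - gradient G p‖ ≤ 2 * M * gradientFreedom S p := by
  rcases hF.nonneg.eq_or_lt with h0 | h0
  · subst h0
    have h1 := hF.norm_gradient_le p
    have h2 := hG.norm_gradient_le p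
    have h3 := norm_sub_le (gradient F p) (gradient G p)
    linarith
  · have h := (hF.sub hG).const_mul (1 / (2 * M))
    rw [abs_of_pos (by positivity), show 1 / (2 * M) * (M + M) = 1 by field_simp; norm_num] at h
    have := norm_gradient_le_gradientFreedom h (S := S)
      (fun x hx => by simp [hS x hx]) p
    rw [C2BddBy.gradient_const_mul_sub hF hG, norm_smul, Real.norm_of_nonneg (by positivity),
      one_div, inv_mul_le_iff₀ (by positivity)] at this
    exact this

/-- A vanishing function nearly realizing `gradientFreedom`. -/
theorem exists_gradientFreedom_le (S : Finset E2) (p : E2) : ∃ G : E2 → ℝ,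
    C2BddBy G 1 ∧ (∀ x ∈ S, G x = 0) ∧ gradientFreedom S p ≤ 2 * ‖gradient G p‖ := by
  rcases (gradientFreedom_nonneg S p).eq_or_lt with h0 | h0
  · exact ⟨_, C2BddBy.zero.mono zero_le_one, fun _ _ => rfl, by rw [← h0]; positivity⟩
  · obtain ⟨r, ⟨G, hG, hS, rfl⟩, hr⟩ := exists_lt_of_lt_csSup
      (nonempty_gradientFreedom S p) (half_lt_self h0)
    rw [← gradientFreedom] at hr
    exact ⟨G, hG, hS, by linarith⟩

/-- The scale below which a finite set looks like a flat curve near a given point, together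
with at most four points witnessing it. -/
theorem exists_flatness_scale (A : Finset E2) : ∃ (W : E2 → ℝ) (S : E2 → Finset E2),
    (∀ p, 0 ≤ W p) ∧ (∀ p q, W q ≤ W p + ‖q - p‖) ∧ (∀ p, S p ⊆ A) ∧ (∀ p, (S p).card ≤ 4) ∧
    (∀ p M (F G : E2 → ℝ), C2BddBy F M → C2BddBy G M → (∀ x ∈ S p, F x = G x) →
      ‖gradient F p - gradient G p‖ ≤ 2 * M * W p) ∧
    (∀ p, ∀ S' ⊆ A, S'.card ≤ 4 → ∃ G : E2 → ℝ, C2BddBy G 1 ∧ (∀ x ∈ S', G x = 0) ∧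
      W p ≤ 2 * ‖gradient G p‖) := by
  classical
  have key : ∀ p, ∃ S ∈ A.powerset.filter (fun S => S.card ≤ 4),
      ∀ S' ∈ A.powerset.filter (fun S => S.card ≤ 4),
        gradientFreedom S p ≤ gradientFreedom S' p := fun p =>
    Finset.exists_min_image _ _ ⟨∅, by simp⟩
  choose S hS hmin using key
  simp only [Finset.mem_filter, Finset.mem_powerset, and_imp] at hS hmin
  refine ⟨fun p => gradientFreedom (S p) p, S, fun p => gradientFreedom_nonneg _ _,
    fun p q => ?_, fun p => (hS p).1, fun p => (hS p).2, fun p M F G hF hG h =>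
      norm_gradient_sub_le_gradientFreedom hF hG h p, fun p S' hS' hc => ?_⟩
  · exact (hmin q (S p) (hS p).1 (hS p).2).trans (gradientFreedom_le_add _ _ _)
  · obtain ⟨G, hG, h0, hle⟩ := exists_gradientFreedom_le S' p
    exact ⟨G, hG, h0, (hmin p S' hS' hc).trans hle⟩

/-- The cross product of two planar vectors. -/
def planeCross (u v : E2) : ℝ := u 0 * v 1 - u 1 * v 0

theorem inner_eq_coords (u v : E2) : inner ℝ u v = u 0 * v 0 + u 1 * v 1 := by
  simp [PiLp.inner_apply, Fin.sum_univ_two, mul_comm]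

theorem norm_sq_eq_coords (u : E2) : ‖u‖ ^ 2 = u 0 ^ 2 + u 1 ^ 2 := by
  simp [EuclideanSpace.real_norm_sq_eq, Fin.sum_univ_two]

theorem planeCross_sq_add_inner_sq (u v : E2) :
    planeCross u v ^ 2 + inner ℝ u v ^ 2 = ‖u‖ ^ 2 * ‖v‖ ^ 2 := by
  rw [planeCross, inner_eq_coords, norm_sq_eq_coords, norm_sq_eq_coords]; ring

theorem abs_planeCross_le (u v : E2) : |planeCross u v| ≤ ‖u‖ * ‖v‖ := by
  refine abs_le_of_sq_le_sq ?_ (mul_nonneg (norm_nonneg u) (norm_nonneg v))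
  nlinarith [planeCross_sq_add_inner_sq u v, sq_nonneg (inner ℝ u v : ℝ)]

theorem norm_mul_abs_planeCross_le (n u v : E2) :
    ‖n‖ * |planeCross u v| ≤ |inner ℝ n u| * ‖v‖ + |inner ℝ n v| * ‖u‖ := by
  have e : ((inner ℝ n u : ℝ) • v - (inner ℝ n v : ℝ) • u : E2) =
      planeCross u v • (!₂[-n 1, n 0] : E2) := by
    ext i
    fin_cases i <;> simp [inner_eq_coords, planeCross] <;> ring
  have e2 : ‖(!₂[-n 1, n 0] : E2)‖ = ‖n‖ := by
    rw [← sq_eq_sq₀ (norm_nonneg _) (norm_nonneg _), norm_sq_eq_coords, norm_sq_eq_coords]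
    simp; ring
  have h := norm_sub_le ((inner ℝ n u : ℝ) • v) ((inner ℝ n v : ℝ) • u)
  rwa [e, norm_smul, norm_smul, norm_smul, e2, Real.norm_eq_abs, Real.norm_eq_abs,
    Real.norm_eq_abs, mul_comm] at h

theorem inner_sub_proj_le {u : E2} (hu : ‖u‖ = 1) (D v : E2) :
    |inner ℝ (D - (inner ℝ u D : ℝ) • u) v| ≤ ‖D‖ * |planeCross u v| := by
  have e : inner ℝ (D - (inner ℝ u D : ℝ) • u) v = planeCross u D * planeCross u v := by
    have h := norm_sq_eq_coords u
    rw [hu] at h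
    simp only [inner_eq_coords, planeCross, PiLp.sub_apply, PiLp.smul_apply, smul_eq_mul]
    linear_combination (D 0 * v 0 + D 1 * v 1) * h
  rw [e, abs_mul]
  have := abs_planeCross_le u D
  rw [hu, one_mul] at this
  gcongr

theorem norm_proj_sub_proj_le {u w : E2} (hu : ‖u‖ = 1) (hw : ‖w‖ = 1) (v : E2) :
    ‖(inner ℝ u v : ℝ) • u - (inner ℝ w v : ℝ) • w‖ ≤ |planeCross u w| * ‖v‖ := by
  rw [← sq_le_sq₀ (norm_nonneg _) (by positivity), mul_pow, sq_abs, norm_sq_eq_coords,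
    norm_sq_eq_coords v]
  have h := norm_sq_eq_coords u
  have h' := norm_sq_eq_coords w
  rw [hu] at h
  rw [hw] at h'
  simp only [inner_eq_coords, planeCross, PiLp.sub_apply, PiLp.smul_apply, smul_eq_mul]
  refine le_of_eq ?_
  linear_combination ((u 0 * v 0 + u 1 * v 1) ^ 2 - (w 0 * v 0 + w 1 * v 1) ^ 2) * (h' - h)

theorem norm_le_abs_add_abs (v : E2) : ‖v‖ ≤ |v 0| + |v 1| := by
  rw [← sq_le_sq₀ (norm_nonneg _) (by positivity), norm_sq_eq_coords]
  nlinarith [abs_nonneg (v 0), abs_nonneg (v 1), sq_abs (v 0), sq_abs (v 1)]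

theorem abs_apply_le_norm (v : E2) (i : Fin 2) : |v i| ≤ ‖v‖ := by
  simpa using PiLp.norm_apply_le v i

theorem norm_proj_le {u : E2} (hu : ‖u‖ = 1) (v : E2) : ‖(inner ℝ u v : ℝ) • u‖ ≤ ‖v‖ := by
  have := abs_real_inner_le_norm u v
  rwa [norm_smul, hu, mul_one, Real.norm_eq_abs, ← one_mul ‖v‖, ← hu]

/-- A maximal subset separated at the scale `W`. -/
theorem exists_separated_net (A : Finset E2) {W : E2 → ℝ} (hW : ∀ p, 0 ≤ W p)
    (hL : ∀ p q, W q ≤ W p + ‖q - p‖) : ∃ N ⊆ A,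
    (∀ p ∈ N, ∀ q ∈ N, p ≠ q → W p + W q ≤ 4 * ‖q - p‖) ∧
    ∀ x ∈ A, ∃ p ∈ N, ‖p - x‖ ≤ W x := by
  classical
  obtain ⟨N, hN, hmax⟩ := (A.powerset.filter fun N => ∀ p ∈ N, ∀ q ∈ N, p ≠ q →
    W p + W q ≤ 4 * ‖q - p‖).exists_max_image Finset.card ⟨∅, by simp⟩
  simp only [Finset.mem_filter, Finset.mem_powerset, and_imp] at hN hmax
  refine ⟨N, hN.1, hN.2, fun x hx => ?_⟩
  by_contra! hc
  have hxN : x ∉ N := fun h => by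
    have := hc x h
    rw [sub_self, norm_zero] at this
    exact absurd (hW x) this.not_ge
  have hsep : ∀ p ∈ N, W p + W x ≤ 4 * ‖p - x‖ := fun p hp => by
    have h1 := hc p hp
    have h2 := hL x p
    linarith [norm_nonneg (p - x)]
  have := hmax (insert x N) (Finset.insert_subset hx hN.1) (by
    intro p hp q hq hpq
    rcases Finset.mem_insert.1 hp with rfl | hp <;> rcases Finset.mem_insert.1 hq with rfl | hq
    · exact absurd rfl hpq
    · linarith [hsep q hq]
    · rw [norm_sub_rev]; exact hsep p (by assumption)
    · exact hN.2 p hp q hq hpq)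
  rw [Finset.card_insert_of_notMem hxN] at this
  omega

/-- Extending a function from a net to a Lipschitz function obeying a size bound. -/
theorem exists_lipschitz_clamp {A N : Finset E2} {h R W : E2 → ℝ} {K : ℝ}
    (hK : 0 ≤ K) (hN : ∀ p ∈ N, ∀ q ∈ N, |h q - h p| ≤ K * ‖q - p‖)
    (hR : ∀ x ∈ A, ∀ y ∈ A, |R y - R x| ≤ K * ‖y - x‖) (hhR : ∀ x ∈ A, |h x| ≤ R x)
    (hnet : ∀ x ∈ A, ∃ p ∈ N, ‖p - x‖ ≤ W x ∧ |h p - h x| ≤ K * W x) :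
    ∃ H : E2 → ℝ, (∀ x ∈ A, ∀ y ∈ A, |H y - H x| ≤ K * ‖y - x‖) ∧
      (∀ x ∈ A, |H x| ≤ R x) ∧ ∀ x ∈ A, |H x - h x| ≤ 2 * K * W x := by
  have hlip : LipschitzOnWith ⟨K, hK⟩ h N := by
    refine LipschitzOnWith.of_dist_le_mul fun p hp q hq => ?_
    rw [Real.dist_eq, dist_eq_norm]
    exact hN q hq p hp
  obtain ⟨G, hG, hGN⟩ := hlip.extend_real
  have hG' : ∀ x y, |G y - G x| ≤ K * ‖y - x‖ := fun x y => by
    have := hG.dist_le_mul y x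
    rwa [Real.dist_eq, dist_eq_norm] at this
  refine ⟨fun x => max (-R x) (min (R x) (G x)), fun x hx y hy => ?_, fun x hx => ?_,
    fun x hx => ?_⟩
  · refine (abs_max_sub_max_le_max _ _ _ _).trans (max_le ?_ ?_)
    · rw [neg_sub_neg, abs_sub_comm]; exact hR x hx y hy
    · exact (abs_min_sub_min_le_max _ _ _ _).trans (max_le (hR x hx y hy) (hG' x y))
  · have := (abs_nonneg _).trans (hhR x hx)
    exact abs_le.2 ⟨le_max_left _ _, max_le (by linarith) (min_le_left _ _)⟩
  · obtain ⟨p, hp, hpx, hph⟩ := hnet x hx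
    have hb := abs_le.1 (hhR x hx)
    have e : h x = max (-R x) (min (R x) (h x)) := by
      rw [min_eq_right hb.2, max_eq_right hb.1]
    have h1 : |G x - h x| ≤ 2 * K * W x := by
      have h2 := abs_add_le (G x - h p) (h p - h x)
      rw [sub_add_sub_cancel] at h2
      have h3 := hG' p x
      rw [norm_sub_rev, ← hGN hp] at h3
      nlinarith [mul_le_mul_of_nonneg_left hpx hK]
    conv_lhs => rw [e]
    refine (abs_max_sub_max_le_max _ _ _ _).trans (max_le (by simp [(abs_nonneg _).trans h1]) ?_)
    exact (abs_min_sub_min_le_max _ _ _ _).trans (max_le (by simp [(abs_nonneg _).trans h1]) h1)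

/-- The unit vector pointing from `x` to `y`. -/
noncomputable def unitTo (x y : E2) : E2 := ‖y - x‖⁻¹ • (y - x)

theorem norm_unitTo {x y : E2} (h : y ≠ x) : ‖unitTo x y‖ = 1 := by
  have : ‖y - x‖ ≠ 0 := norm_ne_zero_iff.2 (sub_ne_zero.2 h)
  rw [unitTo, norm_smul, norm_inv, norm_norm, inv_mul_cancel₀ this]

theorem abs_inner_unitTo_le {x y v : E2} {K : ℝ} (h : y ≠ x)
    (hv : |inner ℝ v (y - x)| ≤ K * ‖y - x‖ ^ 2) :
    |inner ℝ v (unitTo x y)| ≤ K * ‖y - x‖ := by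
  have hp : 0 < ‖y - x‖ := norm_pos_iff.2 (sub_ne_zero.2 h)
  rw [unitTo, inner_smul_right, abs_mul, abs_of_pos (inv_pos.2 hp), inv_mul_le_iff₀ hp]
  linarith

theorem exists_nearest {A : Finset E2} (hA : 2 ≤ A.card) : ∃ ν : E2 → E2,
    ∀ x ∈ A, ν x ∈ A ∧ ν x ≠ x ∧ ∀ y ∈ A, y ≠ x → ‖ν x - x‖ ≤ ‖y - x‖ := by
  classical
  have : ∀ x, ∃ z, x ∈ A → z ∈ A ∧ z ≠ x ∧ ∀ y ∈ A, y ≠ x → ‖z - x‖ ≤ ‖y - x‖ := by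
    intro x
    by_cases hx : x ∈ A
    · obtain ⟨w, hw, hwx⟩ := Finset.exists_mem_ne (by omega : 1 < A.card) x
      obtain ⟨z, hz, hmin⟩ := (A.erase x).exists_min_image (fun z => ‖z - x‖)
        ⟨w, Finset.mem_erase.2 ⟨hwx, hw⟩⟩
      obtain ⟨hzx, hzA⟩ := Finset.mem_erase.1 hz
      exact ⟨z, fun _ => ⟨hzA, hzx, fun y hy hyx => hmin y (Finset.mem_erase.2 ⟨hyx, hy⟩)⟩⟩
    · exact ⟨x, fun h => absurd h hx⟩
  choose ν hν using this
  exact ⟨ν, hν⟩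

/-- Below the flatness scale, chord directions barely turn. -/
theorem flatness_planeCross_le {A : Finset E2} {W : E2 → ℝ}
    (hflat : ∀ p, ∀ S' ⊆ A, S'.card ≤ 4 → ∃ G : E2 → ℝ, C2BddBy G 1 ∧ (∀ x ∈ S', G x = 0) ∧
      W p ≤ 2 * ‖gradient G p‖) {ν : E2 → E2}
    (hν : ∀ x ∈ A, ν x ∈ A ∧ ν x ≠ x ∧ ∀ y ∈ A, y ≠ x → ‖ν x - x‖ ≤ ‖y - x‖)
    {x y : E2} (hx : x ∈ A) (hy : y ∈ A) (hxy : x ≠ y) :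
    W x * |planeCross (unitTo x (ν x)) (y - x)| ≤ 4 * ‖y - x‖ ^ 2 ∧
    W x * |planeCross (unitTo y (ν y)) (unitTo x (ν x))| ≤ 6 * ‖y - x‖ := by
  classical
  obtain ⟨hx1, hx2, hx3⟩ := hν x hx
  obtain ⟨hy1, hy2, hy3⟩ := hν y hy
  obtain ⟨G, hG, h0, hW⟩ := hflat x {x, y, ν x, ν y} (by
    simp [Finset.insert_subset_iff, *]) Finset.card_le_four
  have e1 : G x = 0 := h0 x (by simp)
  have e2 : G y = 0 := h0 y (by simp)
  have e3 : G (ν x) = 0 := h0 _ (by simp)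
  have e4 : G (ν y) = 0 := h0 _ (by simp)
  have t1 : |inner ℝ (gradient G x) (y - x)| ≤ 1 * ‖y - x‖ ^ 2 := by
    exact hG.abs_inner_gradient_le_of_eq (e1.trans e2.symm)
  have t2 := abs_inner_unitTo_le (K := 1) hx2 (hG.abs_inner_gradient_le_of_eq (e1.trans e3.symm))
  have t3 := abs_inner_unitTo_le (K := 1) hy2 (hG.abs_inner_gradient_le_of_eq (e2.trans e4.symm))
  have d1 := hx3 y hy hxy.symm
  have d2 := hy3 x hx hxy
  rw [norm_sub_rev x y] at d2
  have t4 : |inner ℝ (gradient G x) (unitTo y (ν y))| ≤ 2 * ‖y - x‖ := by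
    have h1 := abs_real_inner_le_norm (gradient G x - gradient G y) (unitTo y (ν y))
    have h2 := hG.norm_gradient_sub_le x y
    rw [norm_unitTo hy2, mul_one] at h1
    have h3 := abs_add_le (inner ℝ (gradient G x - gradient G y) (unitTo y (ν y)))
      (inner ℝ (gradient G y) (unitTo y (ν y)))
    rw [← inner_add_left, sub_add_cancel] at h3
    rw [norm_sub_rev x y] at h2
    linarith
  have c1 := norm_mul_abs_planeCross_le (gradient G x) (unitTo x (ν x)) (y - x)
  have c2 := norm_mul_abs_planeCross_le (gradient G x) (unitTo y (ν y)) (unitTo x (ν x))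
  rw [norm_unitTo hx2] at c1 c2
  rw [norm_unitTo hy2] at c2
  constructor
  · nlinarith [mul_le_mul_of_nonneg_right hW (abs_nonneg (planeCross (unitTo x (ν x)) (y - x))),
      mul_le_mul_of_nonneg_right (t2.trans (mul_le_mul_of_nonneg_left d1 zero_le_one))
        (norm_nonneg (y - x))]
  · nlinarith [mul_le_mul_of_nonneg_right hW
      (abs_nonneg (planeCross (unitTo y (ν y)) (unitTo x (ν x))))]

/-- Adding the component of `a - p` along `u` to `p`. -/
noncomputable def correctAlong (u p a : E2) : E2 := p + (inner ℝ u (a - p) : ℝ) • u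

theorem norm_correctAlong_sub_le {u : E2} (hu : ‖u‖ = 1) (p a b : E2) :
    ‖correctAlong u p a - correctAlong u p b‖ = |inner ℝ (a - b) u| := by
  rw [correctAlong, correctAlong, add_sub_add_left_eq_sub, ← sub_smul, ← inner_sub_right,
    sub_sub_sub_cancel_right, norm_smul, hu, mul_one, real_inner_comm, Real.norm_eq_abs]

/-- Along an edge, the corrected jets agree up to the expected order. -/
theorem C2BddBy.correctAlong_le {F : E2 → ℝ} {M : ℝ} (hF : C2BddBy F M)
    {x y u w a b p q : E2} {V : ℝ} (hu : ‖u‖ = 1) (hw : ‖w‖ = 1)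
    (ha : ‖a - gradient F x‖ ≤ 2 * M * V)
    (hau : |inner ℝ (a - gradient F x) u| ≤ 2 * M * ‖y - x‖)
    (hbw : |inner ℝ (b - gradient F y) w| ≤ 2 * M * ‖y - x‖)
    (hp : ‖p - a‖ ≤ 72 * M * V) (hpq : ‖q - p‖ ≤ 36 * M * ‖y - x‖)
    (h1 : V * |planeCross u (y - x)| ≤ 4 * ‖y - x‖ ^ 2)
    (h2 : V * |planeCross w u| ≤ 6 * ‖y - x‖) :
    ‖correctAlong w q b - correctAlong u p a‖ ≤ 600 * M * ‖y - x‖ ∧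
    |F y - F x - inner ℝ (correctAlong u p a) (y - x)| ≤ 600 * M * ‖y - x‖ ^ 2 := by
  have hM := hF.nonneg
  set r := ‖y - x‖ with hr
  have hr0 : 0 ≤ r := norm_nonneg _
  set a' := gradient F x
  set b' := gradient F y
  have hD : ‖a' - p‖ ≤ 74 * M * V := by
    have := norm_add_le (a' - a) (a - p)
    rw [sub_add_sub_cancel, norm_sub_rev a' a, norm_sub_rev a p] at this
    linarith
  have hga := (norm_correctAlong_sub_le hu p a a').trans_le hau
  have hgb := (norm_correctAlong_sub_le hw q b b').trans_le hbw
  constructor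
  · have e : correctAlong w q b - correctAlong u p a =
        (correctAlong w q b - correctAlong w q b') - (correctAlong u p a - correctAlong u p a')
        + ((q - p) + (inner ℝ w ((b' - a') - (q - p)) : ℝ) • w +
          ((inner ℝ w (a' - p) : ℝ) • w - (inner ℝ u (a' - p) : ℝ) • u)) := by
      have e1 : (b' - a') - (q - p) = (b' - q) - (a' - p) := by abel
      rw [e1, inner_sub_right w (b' - q), sub_smul]
      simp only [correctAlong]
      abel
    have t1 := norm_proj_le hw ((b' - a') - (q - p))
    have t2 := norm_sub_le (b' - a') (q - p)
    have t3 := hF.norm_gradient_sub_le y x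
    have t4 := norm_proj_sub_proj_le hw hu (a' - p)
    have t5 : |planeCross w u| * ‖a' - p‖ ≤ 74 * M * (6 * r) := by
      calc |planeCross w u| * ‖a' - p‖ ≤ |planeCross w u| * (74 * M * V) := by gcongr
        _ = 74 * M * (V * |planeCross w u|) := by ring
        _ ≤ _ := by gcongr
    rw [e]
    refine (norm_add_le _ _).trans ?_
    have t6 := norm_sub_le (correctAlong w q b - correctAlong w q b')
      (correctAlong u p a - correctAlong u p a')
    have t7 := norm_add₃_le (a := q - p) (b := (inner ℝ w ((b' - a') - (q - p)) : ℝ) • w)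
      (c := (inner ℝ w (a' - p) : ℝ) • w - (inner ℝ u (a' - p) : ℝ) • u)
    have : 0 ≤ M * r := by positivity
    linarith
  · have e : F y - F x - inner ℝ (correctAlong u p a) (y - x) =
        (F y - F x - inner ℝ a' (y - x)) + inner ℝ (a' - p - (inner ℝ u (a' - p) : ℝ) • u) (y - x)
        - inner ℝ (correctAlong u p a - correctAlong u p a') (y - x) := by
      rw [add_sub_assoc, ← inner_sub_left, sub_add, ← inner_sub_left]
      congr 2
      simp only [correctAlong]
      abel
    have t1 := hF.taylor x y
    have t2 := inner_sub_proj_le hu (a' - p) (y - x)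
    have t3 : ‖a' - p‖ * |planeCross u (y - x)| ≤ 74 * M * (4 * r ^ 2) := by
      calc ‖a' - p‖ * |planeCross u (y - x)| ≤ (74 * M * V) * |planeCross u (y - x)| := by gcongr
        _ = 74 * M * (V * |planeCross u (y - x)|) := by ring
        _ ≤ _ := by gcongr
    have t4 := (abs_real_inner_le_norm (correctAlong u p a - correctAlong u p a') (y - x)).trans
      (mul_le_mul_of_nonneg_right hga hr0)
    rw [e]
    refine (abs_sub _ _).trans ?_
    have t5 := abs_add_le (F y - F x - inner ℝ a' (y - x))
      (inner ℝ (a' - p - (inner ℝ u (a' - p) : ℝ) • u) (y - x))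
    have : 0 ≤ M * r ^ 2 := by positivity
    nlinarith

/-- A Lipschitz approximation of the raw gradients at the scale `W`. -/
theorem exists_lipschitz_approximation {A N : Finset E2} {W R : E2 → ℝ} {h : E2 → E2} {M : ℝ}
    {TA TN : Finset (E2 × E2)} (hM : 0 ≤ M) (hA : Approaches TA A) (hN : Approaches TN N)
    (hTN : TN ⊆ N ×ˢ N)
    (hL : ∀ p q, W q ≤ W p + ‖q - p‖) (hsep : ∀ p ∈ N, ∀ q ∈ N, p ≠ q → W p + W q ≤ 4 * ‖q - p‖)
    (hR : ∀ x y, (x, y) ∈ TA → |R y - R x| ≤ 2 * M * ‖y - x‖)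
    (hhN : ∀ x y, (x, y) ∈ TN → ‖h y - h x‖ ≤ M * (2 * W x + 2 * W y + ‖y - x‖))
    (hhR : ∀ x ∈ A, ‖h x‖ ≤ R x)
    (hnet : ∀ x ∈ A, ∃ p ∈ N, ‖p - x‖ ≤ W x ∧
      ‖h p - h x‖ ≤ M * (2 * W x + 2 * W p + ‖p - x‖)) :
    ∃ H : E2 → E2, (∀ x ∈ A, ∀ y ∈ A, ‖H y - H x‖ ≤ 36 * M * ‖y - x‖) ∧
      (∀ x ∈ A, ‖H x‖ ≤ 2 * R x) ∧ ∀ x ∈ A, ‖H x - h x‖ ≤ 72 * M * W x := by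
  have hN' : ∀ p ∈ N, ∀ q ∈ N, ‖h q - h p‖ ≤ 18 * M * ‖q - p‖ := fun p hp q hq => by
    have := hN.norm_sub_le (h := h) (K := 9 * M) (by positivity) (fun x y hxy => ?_) hp hq
    · linarith
    · rcases eq_or_ne x y with rfl | hne
      · simp
      have hm := Finset.mem_product.1 (hTN hxy)
      have := hsep x hm.1 y hm.2 hne
      nlinarith [hhN x y hxy]
  have hR' : ∀ x ∈ A, ∀ y ∈ A, |R y - R x| ≤ 18 * M * ‖y - x‖ := fun x hx y hy => by
    have := hA.norm_sub_le (h := R) (K := 2 * M) (by positivity)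
      (fun x y hxy => by simpa using hR x y hxy) hx hy
    rw [Real.norm_eq_abs] at this
    nlinarith [mul_nonneg hM (norm_nonneg (y - x))]
  have hi : ∀ i : Fin 2, ∃ H : E2 → ℝ, (∀ x ∈ A, ∀ y ∈ A, |H y - H x| ≤ 18 * M * ‖y - x‖) ∧
      (∀ x ∈ A, |H x| ≤ R x) ∧ ∀ x ∈ A, |H x - h x i| ≤ 2 * (18 * M) * W x := fun i => by
    refine exists_lipschitz_clamp (N := N) (by positivity)
      (fun p hp q hq => (abs_apply_le_norm (h q - h p) i).trans (hN' p hp q hq)) hR'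
      (fun x hx => (abs_apply_le_norm _ i).trans (hhR x hx)) fun x hx => ?_
    obtain ⟨p, hp, hpx, hph⟩ := hnet x hx
    refine ⟨p, hp, hpx, (abs_apply_le_norm (h p - h x) i).trans (hph.trans ?_)⟩
    have hW := (norm_nonneg _).trans hpx
    have := mul_le_mul_of_nonneg_left (show 2 * W x + 2 * W p + ‖p - x‖ ≤ 18 * W x by
      linarith [hL x p]) hM
    linarith
  choose H h1 h2 h3 using hi
  refine ⟨fun x => !₂[H 0 x, H 1 x], fun x hx y hy => ?_, fun x hx => ?_, fun x hx => ?_⟩ <;>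
    refine (norm_le_abs_add_abs _).trans ?_
  · have := h1 0 x hx y hy
    have := h1 1 x hx y hy
    simp only [PiLp.sub_apply, Matrix.cons_val_zero, Matrix.cons_val_one]
    linarith
  · have := h2 0 x hx
    have := h2 1 x hx
    simp only [Matrix.cons_val_zero, Matrix.cons_val_one]
    linarith
  · have := h3 0 x hx
    have := h3 1 x hx
    simp only [PiLp.sub_apply, Matrix.cons_val_zero, Matrix.cons_val_one]
    linarith

/-- A family of first-order jets on `A` that is Whitney regular and admits
nonnegative extensions, with constant `M`. -/
structure IsWhitneyJet (A : Finset E2) (f : E2 → ℝ) (g : E2 → E2) (M : ℝ) : Prop where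
  value_nonneg : ∀ x ∈ A, 0 ≤ f x
  value_le : ∀ x ∈ A, f x ≤ M
  slope_le : ∀ x ∈ A, ‖g x‖ ≤ M
  slope_sq_le : ∀ x ∈ A, ‖g x‖ ^ 2 ≤ M * f x
  slope_sub_le : ∀ x ∈ A, ∀ y ∈ A, ‖g y - g x‖ ≤ M * ‖y - x‖
  taylor : ∀ x ∈ A, ∀ y ∈ A, |f y - f x - inner ℝ (g x) (y - x)| ≤ M * ‖y - x‖ ^ 2

/-- Compatible jets are selected from interpolants on boundedly many points. -/
theorem exists_isWhitneyJet : ∃ k : ℕ, ∀ A : Finset E2, 2 ≤ A.card →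
    ∃ (T : Finset (E2 × E2)) (S : E2 × E2 → Finset E2), T.card ≤ k * A.card ∧
      (∀ q ∈ T, S q ⊆ A ∧ (S q).card ≤ 12) ∧
      ∀ (f : E2 → ℝ) (M : ℝ), (∀ q ∈ T, ∃ F : E2 → ℝ, (∀ y, 0 ≤ F y) ∧
        (∀ x ∈ S q, F x = f x) ∧ C2BddBy F M) → ∃ g, IsWhitneyJet A f g (4800 * M) := by
  classical
  obtain ⟨k, hk⟩ := exists_yao_graph
  refine ⟨2 * k + 2, fun A hcard => ?_⟩
  obtain ⟨W, S, hW0, hWL, hSA, hS4, hWS, hflat⟩ := exists_flatness_scale A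
  obtain ⟨ν, hν⟩ := exists_nearest hcard
  obtain ⟨N, hNA, hsep, hnet⟩ := exists_separated_net A hW0 hWL
  obtain ⟨TA, hTA, hTAc, hTAa⟩ := hk A
  obtain ⟨TN, hTN, hTNc, hTNa⟩ := hk N
  have hnet' : ∀ x, ∃ p, x ∈ A → p ∈ N ∧ ‖p - x‖ ≤ W x := fun x => by
    by_cases hx : x ∈ A
    · obtain ⟨p, hp⟩ := hnet x hx
      exact ⟨p, fun _ => hp⟩
    · exact ⟨x, fun h => absurd h hx⟩
  choose π hπ using hnet'
  set T := (A.image fun x => (x, x)) ∪ TA ∪ TN ∪ (A.image fun x => (x, π x)) with hT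
  have hTT : T ⊆ A ×ˢ A := by
    refine Finset.union_subset (Finset.union_subset (Finset.union_subset ?_ hTA)
      (hTN.trans (Finset.product_subset_product hNA hNA))) ?_ <;>
    · refine Finset.image_subset_iff.2 fun x hx => Finset.mem_product.2 ⟨hx, ?_⟩
      first | exact hx | exact hNA (hπ x hx).1
  refine ⟨T, fun q => S q.1 ∪ S q.2 ∪ {q.1, q.2, ν q.1, ν q.2}, ?_, fun q hq => ⟨?_, ?_⟩,
    fun f M hf => ?_⟩
  · have c1 := Finset.card_union_le ((A.image fun x => (x, x)) ∪ TA ∪ TN)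
      (A.image fun x => (x, π x))
    have c2 := Finset.card_union_le ((A.image fun x => (x, x)) ∪ TA) TN
    have c3 := Finset.card_union_le (A.image fun x => (x, x)) TA
    have c4 := Finset.card_image_le (s := A) (f := fun x => (x, x))
    have c5 := Finset.card_image_le (s := A) (f := fun x => (x, π x))
    have c6 := Nat.mul_le_mul_left k (Finset.card_le_card hNA)
    rw [← hT] at c1
    calc T.card ≤ A.card + k * A.card + k * A.card + A.card := by omega
      _ = _ := by ring
  · obtain ⟨h1, h2⟩ := Finset.mem_product.1 (hTT hq)
    refine Finset.union_subset (Finset.union_subset (hSA _) (hSA _)) ?_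
    simp [Finset.insert_subset_iff, h1, h2, (hν _ h1).1, (hν _ h2).1]
  · have c1 := Finset.card_union_le (S q.1 ∪ S q.2) {q.1, q.2, ν q.1, ν q.2}
    have c2 := Finset.card_union_le (S q.1) (S q.2)
    have c3 : ({q.1, q.2, ν q.1, ν q.2} : Finset E2).card ≤ 4 := Finset.card_le_four
    have := hS4 q.1
    have := hS4 q.2
    change (S q.1 ∪ S q.2 ∪ {q.1, q.2, ν q.1, ν q.2}).card ≤ 12
    omega
  choose! Φ hΦ0 hΦf hΦ using hf
  have hdiag : ∀ x ∈ A, (x, x) ∈ T := fun x hx => by simp [hT, hx]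
  obtain ⟨x₀, hx₀⟩ := Finset.card_pos.1 (by omega : 0 < A.card)
  have hM : 0 ≤ M := (hΦ _ (hdiag x₀ hx₀)).nonneg
  set h : E2 → E2 := fun x => gradient (Φ (x, x)) x with hh
  have hd : ∀ x ∈ A, Φ (x, x) x = f x := fun x hx => hΦf _ (hdiag x hx) x (by simp)
  have hl : ∀ x y, (x, y) ∈ T → Φ (x, y) x = f x := fun x y hxy => hΦf _ hxy x (by simp)
  have hr : ∀ x y, (x, y) ∈ T → Φ (x, y) y = f y := fun x y hxy => hΦf _ hxy y (by simp)
  have hgl : ∀ x y, (x, y) ∈ T → ‖h x - gradient (Φ (x, y)) x‖ ≤ 2 * M * W x := fun x y hxy => by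
    have hx := (Finset.mem_product.1 (hTT hxy)).1
    refine hWS x M _ _ (hΦ _ (hdiag x hx)) (hΦ _ hxy) fun z hz => ?_
    rw [hΦf _ (hdiag x hx) z (by simp [hz]), hΦf _ hxy z (by simp [hz])]
  have hgr : ∀ x y, (x, y) ∈ T → ‖h y - gradient (Φ (x, y)) y‖ ≤ 2 * M * W y := fun x y hxy => by
    have hy := (Finset.mem_product.1 (hTT hxy)).2
    refine hWS y M _ _ (hΦ _ (hdiag y hy)) (hΦ _ hxy) fun z hz => ?_
    rw [hΦf _ (hdiag y hy) z (by simp [hz]), hΦf _ hxy z (by simp [hz])]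
  have hedge : ∀ x y, (x, y) ∈ T → ‖h y - h x‖ ≤ M * (2 * W x + 2 * W y + ‖y - x‖) :=
    fun x y hxy => by
    have e : h y - h x = (h y - gradient (Φ (x, y)) y) +
      (gradient (Φ (x, y)) y - gradient (Φ (x, y)) x) - (h x - gradient (Φ (x, y)) x) := by abel
    have h1 := norm_sub_le ((h y - gradient (Φ (x, y)) y) +
      (gradient (Φ (x, y)) y - gradient (Φ (x, y)) x)) (h x - gradient (Φ (x, y)) x)
    have h2 := norm_add_le (h y - gradient (Φ (x, y)) y)
      (gradient (Φ (x, y)) y - gradient (Φ (x, y)) x)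
    have h3 := (hΦ _ hxy).norm_gradient_sub_le y x
    rw [e]
    linarith [hgl x y hxy, hgr x y hxy]
  have hf0 : ∀ x ∈ A, 0 ≤ f x := fun x hx => hd x hx ▸ hΦ0 _ (hdiag x hx) x
  have hfM : ∀ x ∈ A, f x ≤ M := fun x hx =>
    hd x hx ▸ (abs_le.1 ((hΦ _ (hdiag x hx)).abs_le x)).2
  have hTAT : ∀ x y, (x, y) ∈ TA → (x, y) ∈ T := fun x y hxy => by simp [hT, hxy]
  obtain ⟨H, hH1, hH2, hH3⟩ := exists_lipschitz_approximation (A := A) (N := N) (W := W)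
    (R := fun x => 2 * √(M * f x)) (h := h) hM hTAa hTNa hTN hWL hsep
    (fun x y hxy => by
      have hxy := hTAT x y hxy
      have h1 := (hΦ _ hxy).sqrt_le (hΦ0 _ hxy) x y
      have h2 := (hΦ _ hxy).sqrt_le (hΦ0 _ hxy) y x
      rw [hl x y hxy, hr x y hxy] at h1 h2
      rw [norm_sub_rev x y] at h2
      exact abs_le.2 ⟨by linarith, by linarith⟩)
    (fun x y hxy => hedge x y (by simp [hT, hxy]))
    (fun x hx => hd x hx ▸ (hΦ _ (hdiag x hx)).norm_gradient_le_sqrt (hΦ0 _ (hdiag x hx)) x)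
    (fun x hx => ⟨π x, (hπ x hx).1, (hπ x hx).2, hedge x (π x) (by
      simp only [hT, Finset.mem_union, Finset.mem_image]
      exact Or.inr ⟨x, hx, rfl⟩)⟩)
  set g : E2 → E2 := fun x => correctAlong (unitTo x (ν x)) (H x) (h x) with hg
  have hgT : ∀ x y, (x, y) ∈ TA → ‖g y - g x‖ ≤ 600 * M * ‖y - x‖ ∧
      |f y - f x - inner ℝ (g x) (y - x)| ≤ 600 * M * ‖y - x‖ ^ 2 := fun x y hxy => by
    have hxy := hTAT x y hxy
    obtain ⟨hx, hy⟩ := Finset.mem_product.1 (hTT hxy)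
    rcases eq_or_ne x y with rfl | hne
    · simp
    obtain ⟨hx1, hx2, hx3⟩ := hν x hx
    obtain ⟨hy1, hy2, hy3⟩ := hν y hy
    have hF := hΦ _ hxy
    have cx := abs_inner_unitTo_le (K := 2 * M) hx2
      ((hΦ _ (hdiag x hx)).abs_inner_gradient_sub_le_of_eq hF
        ((hd x hx).trans (hl x y hxy).symm)
        ((hΦf _ (hdiag x hx) (ν x) (by simp)).trans (hΦf _ hxy (ν x) (by simp)).symm))
    have cy := abs_inner_unitTo_le (K := 2 * M) hy2
      ((hΦ _ (hdiag y hy)).abs_inner_gradient_sub_le_of_eq hF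
        ((hd y hy).trans (hr x y hxy).symm)
        ((hΦf _ (hdiag y hy) (ν y) (by simp)).trans (hΦf _ hxy (ν y) (by simp)).symm))
    have dx := mul_le_mul_of_nonneg_left (hx3 y hy hne.symm) (by positivity : 0 ≤ 2 * M)
    have dy := mul_le_mul_of_nonneg_left (hy3 x hx hne) (by positivity : 0 ≤ 2 * M)
    rw [norm_sub_rev x y] at dy
    obtain ⟨f1, f2⟩ := flatness_planeCross_le hflat hν hx hy hne
    have := hF.correctAlong_le (x := x) (y := y) (norm_unitTo hx2) (norm_unitTo hy2)
      (hgl x y hxy) (cx.trans dx) (cy.trans dy) (hH3 x hx) (hH1 x hx y hy) f1 f2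
    rwa [hl x y hxy, hr x y hxy] at this
  have hgA : ∀ x ∈ A, ∀ y ∈ A, ‖g y - g x‖ ≤ 1200 * M * ‖y - x‖ := fun x hx y hy => by
    have := hTAa.norm_sub_le (h := g) (K := 600 * M) (by positivity)
      (fun x y hxy => (hgT x y hxy).1) hx hy
    linarith
  have hgR : ∀ x ∈ A, ‖g x‖ ≤ 10 * √(M * f x) := fun x hx => by
    have h1 := norm_add_le (H x) ((inner ℝ (unitTo x (ν x)) (h x - H x) : ℝ) • unitTo x (ν x))
    have h2 := norm_proj_le (norm_unitTo (hν x hx).2.1) (h x - H x)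
    have h3 := norm_sub_le (h x) (H x)
    have h4 := hH2 x hx
    have h5 : ‖h x‖ ≤ 2 * √(M * f x) :=
      hd x hx ▸ (hΦ _ (hdiag x hx)).norm_gradient_le_sqrt (hΦ0 _ (hdiag x hx)) x
    simp only [hg, correctAlong]
    linarith
  refine ⟨g, hf0, fun x hx => (hfM x hx).trans (by linarith), fun x hx => ?_, fun x hx => ?_,
    fun x hx y hy => (hgA x hx y hy).trans ?_, fun x hx y hy => ?_⟩
  · have h1 : √(M * f x) ≤ M := by
      rw [Real.sqrt_le_iff]
      exact ⟨hM, by nlinarith [hfM x hx]⟩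
    linarith [hgR x hx]
  · have h0 := mul_nonneg hM (hf0 x hx)
    have h1 := pow_le_pow_left₀ (norm_nonneg _) (hgR x hx) 2
    rw [mul_pow, Real.sq_sqrt h0] at h1
    linarith
  · have := mul_nonneg hM (norm_nonneg (y - x))
    linarith
  · have := hTAa.taylor (f := f) (g := g) (K := 1200 * M) (by positivity) hgA
      (fun x y hxy => (hgT x y hxy).2.trans (by
        have := mul_nonneg hM (sq_nonneg ‖y - x‖)
        linarith)) hx hy
    linarith

/-- The symmetric second differences of `u` are at most `2 * K * ‖h‖ ^ 2`. -/
def SecondDiffBdd (u : E2 → ℝ) (K : ℝ) : Prop :=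
  ∀ y h, |u (y + h) + u (y - h) - 2 * u y| ≤ 2 * K * ‖h‖ ^ 2

namespace SecondDiffBdd

variable {u v : E2 → ℝ} {K K' : ℝ}

theorem nonneg (hu : SecondDiffBdd u K) : 0 ≤ K := by
  have := (abs_nonneg _).trans (hu 0 (EuclideanSpace.single 0 1))
  simp at this
  linarith

theorem sub (hu : SecondDiffBdd u K) (hv : SecondDiffBdd v K') :
    SecondDiffBdd (fun y => u y - v y) (K + K') := fun y h => by
  have h1 := abs_le.1 (hu y h)
  have h2 := abs_le.1 (hv y h)
  refine abs_le.2 ⟨by linarith, by linarith⟩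

theorem abs_sub_two_pow_mul_le (hu : SecondDiffBdd u K) (y h : E2) (n : ℕ) :
    |u (y + h) - u y - 2 ^ n * (u (y + ((2 : ℝ) ^ n)⁻¹ • h) - u y)| ≤
      K * ‖h‖ ^ 2 * (1 - ((2 : ℝ) ^ n)⁻¹) := by
  induction n with
  | zero => simp
  | succ n ih =>
    set a : ℝ := ((2 : ℝ) ^ (n + 1))⁻¹ with ha
    have ha0 : 0 < a := by positivity
    have h2 : ((2 : ℝ) ^ n)⁻¹ = 2 * a := by rw [ha, pow_succ]; field_simp
    have h3 : (2 : ℝ) ^ n = (2 * a)⁻¹ := by rw [← h2, inv_inv]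
    have h4 : (2 : ℝ) ^ (n + 1) = a⁻¹ := by rw [ha, inv_inv]
    have h5 := hu (y + a • h) (a • h)
    rw [add_assoc, ← add_smul, ← two_mul, add_sub_cancel_right, norm_smul,
      Real.norm_of_nonneg ha0.le] at h5
    rw [h2, h3] at ih
    rw [h4]
    have e : u (y + h) - u y - a⁻¹ * (u (y + a • h) - u y) =
        (u (y + h) - u y - (2 * a)⁻¹ * (u (y + (2 * a) • h) - u y)) +
        (2 * a)⁻¹ * (u (y + (2 * a) • h) + u y - 2 * u (y + a • h)) := by
      field_simp; ring
    have h6 : |(2 * a)⁻¹ * (u (y + (2 * a) • h) + u y - 2 * u (y + a • h))| ≤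
        K * ‖h‖ ^ 2 * a := by
      rw [abs_mul, abs_of_pos (by positivity), inv_mul_le_iff₀ (by positivity)]
      refine h5.trans (le_of_eq ?_)
      ring
    rw [e]
    refine (abs_add_le _ _).trans ((add_le_add ih h6).trans (le_of_eq ?_))
    ring

theorem taylor (hu : SecondDiffBdd u K) {y : E2} (hd : DifferentiableAt ℝ u y) (h : E2) :
    |u (y + h) - u y - fderiv ℝ u y h| ≤ K * ‖h‖ ^ 2 := by
  have h1 : Filter.Tendsto (fun n : ℕ => (2 : ℝ) ^ n) Filter.atTop Filter.atTop :=
    tendsto_pow_atTop_atTop_of_one_lt one_lt_two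
  have h2 := hd.hasFDerivAt.lim h (c := fun n : ℕ => (2 : ℝ) ^ n) (l := Filter.atTop) (by
    simpa using h1)
  refine le_of_tendsto ((h2.const_sub (u (y + h) - u y)).abs) (Filter.Eventually.of_forall
    fun n => ?_)
  refine (hu.abs_sub_two_pow_mul_le y h n).trans ?_
  have : 0 ≤ ((2 : ℝ) ^ n)⁻¹ := by positivity
  have := mul_nonneg hu.nonneg (sq_nonneg ‖h‖)
  nlinarith

theorem norm_fderiv_sub_le (hu : SecondDiffBdd u K) (hd : Differentiable ℝ u) (x y : E2) :
    ‖fderiv ℝ u y - fderiv ℝ u x‖ ≤ 6 * K * ‖y - x‖ := by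
  rcases eq_or_ne y x with rfl | hne
  · simp
  have hr : 0 < ‖y - x‖ := norm_pos_iff.2 (sub_ne_zero.2 hne)
  have hK := hu.nonneg
  have key : ∀ w, ‖w‖ = ‖y - x‖ →
      |(fderiv ℝ u y - fderiv ℝ u x) w| ≤ 6 * K * ‖y - x‖ * ‖w‖ := fun w hw => by
    have h1 := hu.taylor (hd y) w
    have h2 := hu.taylor (hd x) (y - x)
    have h3 := hu.taylor (hd x) (y - x + w)
    have e : x + (y - x + w) = y + w := by abel
    rw [e, map_add] at h3
    rw [add_sub_cancel] at h2
    have h4 : ‖y - x + w‖ ^ 2 ≤ (2 * ‖y - x‖) ^ 2 := by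
      gcongr
      linarith [norm_add_le (y - x) w]
    have h5 := mul_le_mul_of_nonneg_left h4 hK
    rw [hw] at h1 ⊢
    rw [sub_apply]
    have h1 := abs_le.1 h1
    have h2 := abs_le.1 h2
    have h3 := abs_le.1 h3
    exact abs_le.2 ⟨by nlinarith, by nlinarith⟩
  refine ContinuousLinearMap.opNorm_le_bound _ (by positivity) fun w => ?_
  rcases eq_or_ne w 0 with rfl | hw0
  · simp
  have hw : 0 < ‖w‖ := norm_pos_iff.2 hw0
  have hc : 0 < ‖y - x‖ / ‖w‖ := by positivity
  have h1 := key ((‖y - x‖ / ‖w‖) • w) (by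
    rw [norm_smul, Real.norm_of_nonneg hc.le]; field_simp)
  rw [map_smul, smul_eq_mul, abs_mul, abs_of_pos hc, norm_smul, Real.norm_of_nonneg hc.le,
    mul_left_comm] at h1
  exact le_of_mul_le_mul_left h1 hc

theorem norm_iteratedFDeriv_two_le (hu : SecondDiffBdd u K) (hd : Differentiable ℝ u) (y : E2) :
    ‖iteratedFDeriv ℝ 2 u y‖ ≤ 6 * K := by
  have hK := hu.nonneg
  rw [← norm_iteratedFDeriv_fderiv, norm_iteratedFDeriv_one]
  refine norm_fderiv_le_of_lipschitz (C := ⟨6 * K, by positivity⟩) ℝ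
    (LipschitzWith.of_dist_le_mul fun x y => ?_)
  rw [dist_eq_norm, dist_eq_norm]
  exact hu.norm_fderiv_sub_le hd y x

theorem norm_iteratedFDeriv_one_le (hu : SecondDiffBdd u K) {y : E2}
    (hd : DifferentiableAt ℝ u y) {m r : ℝ} (hr : 0 < r) (hm : 0 ≤ m)
    (hb : ∀ z, ‖z - y‖ ≤ r → |u z - u y| ≤ m) :
    ‖iteratedFDeriv ℝ 1 u y‖ ≤ (m + K * r ^ 2) / r := by
  have hK := hu.nonneg
  rw [norm_iteratedFDeriv_one]
  refine ContinuousLinearMap.opNorm_le_bound _ (by positivity) fun w => ?_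
  rcases eq_or_ne w 0 with rfl | hw0
  · simp
  have hw : 0 < ‖w‖ := norm_pos_iff.2 hw0
  have hc : 0 < r / ‖w‖ := by positivity
  have hn : ‖(r / ‖w‖) • w‖ = r := by
    rw [norm_smul, Real.norm_of_nonneg hc.le]; field_simp
  have h1 := hu.taylor hd ((r / ‖w‖) • w)
  have h2 := hb (y + (r / ‖w‖) • w) (by rw [add_sub_cancel_left, hn])
  rw [hn] at h1
  have h3 : |fderiv ℝ u y ((r / ‖w‖) • w)| ≤ m + K * r ^ 2 := by
    have h1 := abs_le.1 h1
    have h2 := abs_le.1 h2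
    exact abs_le.2 ⟨by linarith, by linarith⟩
  rw [map_smul, smul_eq_mul, abs_mul, abs_of_pos hc] at h3
  rw [Real.norm_eq_abs]
  calc |fderiv ℝ u y w| = (r / ‖w‖ * |fderiv ℝ u y w|) * (‖w‖ / r) := by field_simp
    _ ≤ (m + K * r ^ 2) * (‖w‖ / r) := by gcongr
    _ = _ := by ring

end SecondDiffBdd

/-- Between a family of semiconcave functions and all paraboloids below it, there is a function
with bounded second differences. -/
theorem exists_secondDiffBdd_between {𝒬 : Set (E2 → ℝ)} {K : ℝ} (hne : 𝒬.Nonempty)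
    (hK : 0 ≤ K) (h0 : ∀ q ∈ 𝒬, ∀ y, 0 ≤ q y)
    (hq : ∀ q ∈ 𝒬, ∀ y h, q (y + h) + q (y - h) - 2 * q y ≤ 2 * K * ‖h‖ ^ 2) :
    ∃ u : E2 → ℝ, Measurable u ∧ SecondDiffBdd u K ∧ (∀ y, 0 ≤ u y) ∧
      (∀ q ∈ 𝒬, ∀ y, u y ≤ q y) ∧
      ∀ (a : E2) (b : ℝ), (∀ q ∈ 𝒬, ∀ y, inner ℝ a y + b - K * ‖y‖ ^ 2 ≤ q y) →
        ∀ y, inner ℝ a y + b - K * ‖y‖ ^ 2 ≤ u y := by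
  set I := {p : E2 × ℝ // ∀ q ∈ 𝒬, ∀ y, inner ℝ p.1 y + p.2 - K * ‖y‖ ^ 2 ≤ q y} with hI
  set ℓ : I → E2 → ℝ := fun p y => inner ℝ p.1.1 y + p.1.2 with hℓ
  have hpar : ∀ (h : E2), ∀ y : E2, ‖y + h‖ ^ 2 + ‖y - h‖ ^ 2 = 2 * ‖y‖ ^ 2 + 2 * ‖h‖ ^ 2 :=
    fun h y => by
      have := parallelogram_law_with_norm ℝ y h
      nlinarith
  have htan : ∀ z : E2, ∀ q ∈ 𝒬, ∀ y,
      inner ℝ ((2 * K) • z) y + -(K * ‖z‖ ^ 2) - K * ‖y‖ ^ 2 ≤ q y := fun z q hq y => by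
    have h1 := norm_sub_sq_real z y
    have h2 := mul_nonneg hK (sq_nonneg ‖z - y‖)
    rw [inner_smul_left]
    simp only [conj_trivial]
    nlinarith [h0 q hq y]
  have : Nonempty I := ⟨⟨((2 * K) • 0, -(K * ‖(0 : E2)‖ ^ 2)), htan 0⟩⟩
  have hbdd : ∀ y, BddAbove (Set.range fun p => ℓ p y) := fun y => by
    obtain ⟨q, hq⟩ := hne
    refine ⟨q y + K * ‖y‖ ^ 2, ?_⟩
    rintro _ ⟨p, rfl⟩
    have := p.2 q hq y
    simp only [hℓ]
    linarith
  set V : E2 → ℝ := fun y => ⨆ p, ℓ p y with hV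
  have hle : ∀ p y, ℓ p y ≤ V y := fun p y => le_ciSup (hbdd y) p
  have hconv : ∀ y h, 2 * V y ≤ V (y + h) + V (y - h) := fun y h => by
    have : V y ≤ (V (y + h) + V (y - h)) / 2 := by
      refine ciSup_le fun p => ?_
      have h1 := hle p (y + h)
      have h2 := hle p (y - h)
      simp only [hℓ, inner_add_right, inner_sub_right] at h1 h2 ⊢
      linarith
    linarith
  have hsemi : ∀ y h, V (y + h) + V (y - h) - 2 * V y ≤ 4 * K * ‖h‖ ^ 2 := fun y h => by
    have : ∀ p p' : I, ℓ p (y + h) + ℓ p' (y - h) ≤ 2 * V y + 4 * K * ‖h‖ ^ 2 := fun p p' => by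
      let m : I := ⟨((1 / 2 : ℝ) • (p.1.1 + p'.1.1),
        (ℓ p h + ℓ p' (-h)) / 2 - 2 * K * ‖h‖ ^ 2), fun q hq' z => by
          have h1 := p.2 q hq' (z + h)
          have h2 := p'.2 q hq' (z - h)
          have h3 := hq q hq' z h
          have h4 := congrArg (K * ·) (hpar h z)
          simp only [hℓ, inner_smul_left, inner_add_left, inner_add_right, inner_sub_right,
            inner_neg_right, conj_trivial] at h1 h2 h4 ⊢
          linarith⟩
      have := hle m y
      simp only [m, hℓ, inner_smul_left, inner_add_left, inner_add_right, inner_sub_right,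
            inner_neg_right, conj_trivial] at this ⊢
      linarith
    have h1 : ∀ p', V (y + h) ≤ 2 * V y + 4 * K * ‖h‖ ^ 2 - ℓ p' (y - h) := fun p' =>
      ciSup_le fun p => by linarith [this p p']
    have h2 : V (y - h) ≤ 2 * V y + 4 * K * ‖h‖ ^ 2 - V (y + h) :=
      ciSup_le fun p' => by linarith [h1 p']
    linarith
  refine ⟨fun y => V y - K * ‖y‖ ^ 2, ?_, fun y h => ?_, fun z => ?_, fun q hq' y => ?_,
    fun a b hab y => ?_⟩
  · refine (lowerSemicontinuous_ciSup hbdd fun p => ?_).measurable.sub (by fun_prop)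
    exact Continuous.lowerSemicontinuous (by fun_prop)
  · have h1 := hconv y h
    have h2 := hsemi y h
    have h3 := congrArg (K * ·) (hpar h y)
    exact abs_le.2 ⟨by linarith, by linarith⟩
  · have := hle ⟨((2 * K) • z, -(K * ‖z‖ ^ 2)), htan z⟩ z
    simp only [hℓ, inner_smul_left, conj_trivial, real_inner_self_eq_norm_sq] at this
    linarith
  · have : V y ≤ q y + K * ‖y‖ ^ 2 := ciSup_le fun p => by
      have := p.2 q hq' y
      simp only [hℓ]
      linarith
    linarith
  · have := hle ⟨(a, b), hab⟩ y
    simp only [hℓ] at this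
    linarith

open MeasureTheory in
/-- Mollification of a bounded function with bounded second differences. -/
theorem SecondDiffBdd.exists_contDiff_approx {u : E2 → ℝ} {K B s : ℝ} (hu : SecondDiffBdd u K)
    (hm : Measurable u) (h0 : ∀ y, 0 ≤ u y) (hB : ∀ y, u y ≤ B) (hs : 0 < s) :
    ∃ v : E2 → ℝ, ContDiff ℝ 2 v ∧ SecondDiffBdd v K ∧ (∀ y, 0 ≤ v y) ∧ (∀ y, v y ≤ B) ∧
      ∀ y, |v y - u y| ≤ K * s ^ 2 := by
  have hK := hu.nonneg
  let φ : ContDiffBump (0 : E2) := ⟨s / 2, s, by positivity, by linarith⟩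
  set η : E2 → ℝ := φ.normed volume with hη
  have hη0 : ∀ z, 0 ≤ η z := φ.nonneg_normed
  have hηs : ∀ z, s ≤ ‖z‖ → η z = 0 := fun z hz => by
    rw [← Function.notMem_support, hη, φ.support_normed_eq, Metric.mem_ball, dist_zero_right]
    exact hz.not_gt
  have hint : Integrable η := φ.integrable_normed
  have h1 : ∫ z, η z = 1 := φ.integral_normed
  have hub : ∀ y, ‖u y‖ ≤ B := fun y => by
    rw [Real.norm_of_nonneg (h0 y)]; exact hB y
  have hI : ∀ g : E2 → E2, Measurable g → Integrable fun z => η z * u (g z) := fun g hg =>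
    hint.mul_bdd (hm.comp hg).aestronglyMeasurable (Filter.Eventually.of_forall fun z => hub _)
  have hI1 : ∀ c : ℝ, Integrable fun z => η z * c := fun c => hint.mul_const c
  have hc : ∀ c : ℝ, ∫ z, η z * c = c := fun c => by rw [integral_mul_const, h1, one_mul]
  set v : E2 → ℝ := fun y => ∫ z, η z * u (y - z) with hv
  have hv' : ∀ y, v y = ∫ z, η z * u (y + z) := fun y => by
    rw [hv, ← integral_neg_eq_self]
    simp only [← sub_eq_add_neg, hη, φ.normed_neg]
  refine ⟨v, ?_, fun y h => ?_, fun y => ?_, fun y => ?_, fun y => ?_⟩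
  · have hloc : LocallyIntegrable u volume :=
      (locallyIntegrable_const B).mono hm.aestronglyMeasurable
        (Filter.Eventually.of_forall fun y => (hub y).trans (le_abs_self B))
    exact HasCompactSupport.contDiff_convolution_left (n := 2) (ContinuousLinearMap.lsmul ℝ ℝ)
      φ.hasCompactSupport_normed φ.contDiff_normed hloc
  · have e : v (y + h) + v (y - h) - 2 * v y =
        ∫ z, η z * (u (y - z + h) + u (y - z - h) - 2 * u (y - z)) := by
      have i1 := hI (fun z => y + h - z) (by fun_prop)
      have i2 := hI (fun z => y - h - z) (by fun_prop)
      have i3 := (hI (fun z => y - z) (by fun_prop)).const_mul 2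
      have i4 : Integrable fun z => η z * u (y + h - z) + η z * u (y - h - z) := i1.add i2
      simp only [hv]
      rw [← integral_const_mul, ← integral_add i1 i2, ← integral_sub i4 i3]
      refine integral_congr_ae (Filter.Eventually.of_forall fun z => ?_)
      simp only [add_sub_right_comm y h z, sub_right_comm y h z]
      ring
    rw [e, ← hc (2 * K * ‖h‖ ^ 2), ← Real.norm_eq_abs]
    refine norm_integral_le_of_norm_le (hI1 _) (Filter.Eventually.of_forall fun z => ?_)
    rw [norm_mul, Real.norm_of_nonneg (hη0 z)]
    exact mul_le_mul_of_nonneg_left (hu _ _) (hη0 z)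
  · exact integral_nonneg fun z => mul_nonneg (hη0 z) (h0 _)
  · rw [← hc B]
    exact integral_mono (hI _ (by fun_prop)) (hI1 B) fun z =>
      mul_le_mul_of_nonneg_left (hB _) (hη0 z)
  · have e : 2 * (v y - u y) = ∫ z, η z * (u (y + z) + u (y - z) - 2 * u y) := by
      have : 2 * (v y - u y) = (∫ z, η z * u (y + z)) + (∫ z, η z * u (y - z)) -
          ∫ z, η z * (2 * u y) := by
        rw [← hv', hc]; ring
      have i1 := hI (fun z => y + z) (by fun_prop)
      have i2 := hI (fun z => y - z) (by fun_prop)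
      have i3 : Integrable fun z => η z * u (y + z) + η z * u (y - z) := i1.add i2
      rw [this, ← integral_add i1 i2, ← integral_sub i3 (hI1 _)]
      refine integral_congr_ae (Filter.Eventually.of_forall fun z => ?_)
      simp only
      ring
    have h3 : |2 * (v y - u y)| ≤ 2 * K * s ^ 2 := by
      rw [e, ← hc (2 * K * s ^ 2), ← Real.norm_eq_abs]
      refine norm_integral_le_of_norm_le (hI1 _) (Filter.Eventually.of_forall fun z => ?_)
      rw [norm_mul, Real.norm_of_nonneg (hη0 z)]
      rcases le_or_gt s ‖z‖ with hz | hz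
      · simp [hηs z hz]
      · refine mul_le_mul_of_nonneg_left ((hu y z).trans ?_) (hη0 z)
        gcongr
    rw [abs_mul, abs_two] at h3
    linarith

/-- A smooth cutoff, together with scale-invariant bounds for its rescalings. -/
theorem exists_cutoff : ∃ B : ℝ, 0 ≤ B ∧ ∀ (x : E2) (s : ℝ), 0 < s → ∃ χ : E2 → ℝ,
    ContDiff ℝ 2 χ ∧ χ x = 1 ∧ (∀ y, 0 ≤ χ y) ∧ (∀ y, χ y ≤ 1) ∧
    (∀ y, ∀ i : ℕ, 2 * s < ‖y - x‖ → iteratedFDeriv ℝ i χ y = 0) ∧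
    ∀ y, ∀ i : ℕ, i ≤ 2 → ‖iteratedFDeriv ℝ i χ y‖ ≤ B * (s ^ i)⁻¹ := by
  let φ : ContDiffBump (0 : E2) := ⟨1, 2, one_pos, one_lt_two⟩
  have hφ : ∀ n : ℕ∞, ContDiff ℝ n φ := fun n => φ.contDiff
  have hb : ∀ i : ℕ, ∃ B, ∀ y, ‖iteratedFDeriv ℝ i φ y‖ ≤ B := fun i =>
    (φ.hasCompactSupport.iteratedFDeriv i).exists_bound_of_continuous
      ((hφ i).continuous_iteratedFDeriv le_rfl)
  choose B hB using hb
  have hB0 : ∀ i, 0 ≤ B i := fun i => (norm_nonneg _).trans (hB i 0)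
  refine ⟨B 0 + B 1 + B 2, by linarith [hB0 0, hB0 1, hB0 2], fun x s hs => ?_⟩
  have key : ∀ i : ℕ, ∀ y, iteratedFDeriv ℝ i (fun y => φ (s⁻¹ • (y - x))) y =
      s⁻¹ ^ i • iteratedFDeriv ℝ i φ (s⁻¹ • (y - x)) := fun i y => by
    rw [iteratedFDeriv_comp_sub (f := fun z => φ (s⁻¹ • z)), iteratedFDeriv_comp_const_smul _ (hφ i)]
  refine ⟨fun y => φ (s⁻¹ • (y - x)), (hφ 2).comp (by fun_prop), ?_, fun y => φ.nonneg,
    fun y => φ.le_one, fun y i hy => ?_, fun y i hi => ?_⟩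
  · simp only [sub_self, smul_zero]
    exact φ.one_of_mem_closedBall (by simp [φ])
  · have : iteratedFDeriv ℝ i φ (s⁻¹ • (y - x)) = 0 := by
      rw [← Function.notMem_support]
      refine fun h => ?_
      have := support_iteratedFDeriv_subset i h
      rw [φ.tsupport_eq, Metric.mem_closedBall, dist_zero_right, norm_smul, norm_inv,
        Real.norm_of_nonneg hs.le, inv_mul_le_iff₀ hs] at this
      change ‖y - x‖ ≤ s * 2 at this
      linarith
    rw [key, this, smul_zero]
  · rw [key, norm_smul, norm_pow, norm_inv, Real.norm_of_nonneg hs.le, inv_pow, mul_comm]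
    refine mul_le_mul_of_nonneg_right ((hB i _).trans ?_) (by positivity)
    interval_cases i <;> linarith [hB0 0, hB0 1, hB0 2]

theorem Finset.exists_separation (A : Finset E2) :
    ∃ s : ℝ, 0 < s ∧ s ≤ 1 ∧ ∀ x ∈ A, ∀ y ∈ A, x ≠ y → 4 * s < ‖y - x‖ := by
  have : ∃ δ : ℝ, 0 < δ ∧ ∀ p ∈ A.offDiag, δ ≤ ‖p.2 - p.1‖ := by
    rcases A.offDiag.eq_empty_or_nonempty with h | h
    · exact ⟨1, one_pos, by simp [h]⟩
    · obtain ⟨q, hq, hmin⟩ := A.offDiag.exists_min_image (fun p => ‖p.2 - p.1‖) h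
      exact ⟨_, norm_pos_iff.2 (sub_ne_zero.2 (Finset.mem_offDiag.1 hq).2.2.symm), hmin⟩
  obtain ⟨δ, hδ, h⟩ := this
  refine ⟨min 1 (δ / 5), by positivity, min_le_left _ _, fun x hx y hy hxy => ?_⟩
  have := h (x, y) (Finset.mem_offDiag.2 ⟨hx, hy, hxy⟩)
  have := min_le_right 1 (δ / 5)
  simp only at *
  linarith

/-- Replacing a function near each point of a finite set by a close function. -/
theorem exists_glue : ∃ B : ℝ, 0 ≤ B ∧ ∀ (A : Finset E2) (v : E2 → ℝ) (φ : E2 → E2 → ℝ)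
    (s c M : ℝ), A.Nonempty → 0 < s → s ≤ 1 → (∀ x ∈ A, ∀ y ∈ A, x ≠ y → 4 * s < ‖y - x‖) →
    C2BddBy v M → (∀ x ∈ A, ContDiff ℝ 2 (φ x)) → (∀ y, 0 ≤ v y) → (∀ x ∈ A, ∀ y, 0 ≤ φ x y) →
    0 ≤ c → (∀ x ∈ A, ∀ y, ‖y - x‖ ≤ 2 * s → ∀ i : ℕ, i ≤ 2 →
      ‖iteratedFDeriv ℝ i (fun z => φ x z - v z) y‖ ≤ c * s ^ 2 * (s ^ i)⁻¹) →
    ∃ F : E2 → ℝ, (∀ y, 0 ≤ F y) ∧ (∀ x ∈ A, F x = φ x x) ∧ C2BddBy F (M + B * c) := by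
  obtain ⟨B, hB, hχ⟩ := exists_cutoff
  refine ⟨4 * B, by positivity, fun A v φ s c M hA hs hs1 hsep hv hφ hv0 hφ0 hc hw => ?_⟩
  choose! χ hχc hχ1 hχ0 hχle hχz hχb using fun x => hχ x s hs
  have hnear : ∀ y, ∃ x ∈ A, ∀ z ∈ A, z ≠ x → 2 * s < ‖y - z‖ := fun y => by
    by_cases h : ∃ x ∈ A, ‖y - x‖ ≤ 2 * s
    · obtain ⟨x, hx, hxy⟩ := h
      refine ⟨x, hx, fun z hz hzx => ?_⟩
      have h1 := hsep z hz x hx hzx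
      have h2 := norm_sub_le (y - z) (y - x)
      rw [sub_sub_sub_cancel_left] at h2
      linarith
    · obtain ⟨x, hx⟩ := hA
      push Not at h
      exact ⟨x, hx, fun z hz _ => h z hz⟩
  have hχy : ∀ x y, 2 * s < ‖y - x‖ → χ x y = 0 := fun x y h => by
    have := congrArg (‖·‖) (hχz x y 0 h)
    simpa using this
  set w : E2 → E2 → ℝ := fun x y => φ x y - v y with hwdef
  set t : E2 → E2 → ℝ := fun x y => χ x y * w x y with ht
  have hwc : ∀ x ∈ A, ContDiff ℝ 2 (w x) := fun x hx => (hφ x hx).sub hv.1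
  have htc : ∀ x ∈ A, ContDiff ℝ 2 (t x) := fun x hx => (hχc x).mul (hwc x hx)
  have hcast : ∀ i : ℕ, i ≤ 2 → ((i : ℕ) : WithTop ℕ∞) ≤ 2 := fun i hi => by exact_mod_cast hi
  have htz : ∀ x ∈ A, ∀ y, 2 * s < ‖y - x‖ → ∀ i : ℕ, i ≤ 2 → iteratedFDeriv ℝ i (t x) y = 0 :=
    fun x hx y hy i hi => by
      have h1 := norm_iteratedFDeriv_mul_le (hχc x) (hwc x hx) y (hcast i hi)
      rw [Finset.sum_eq_zero fun j _ => by rw [hχz x y j hy]; simp] at h1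
      exact norm_le_zero_iff.1 h1
  have htb : ∀ x ∈ A, ∀ y, ∀ i : ℕ, i ≤ 2 → ‖iteratedFDeriv ℝ i (t x) y‖ ≤ 4 * B * c :=
    fun x hx y i hi => by
      rcases lt_or_ge (2 * s) ‖y - x‖ with hy | hy
      · rw [htz x hx y hy i hi, norm_zero]; positivity
      refine (norm_iteratedFDeriv_mul_le (hχc x) (hwc x hx) y (hcast i hi)).trans ?_
      have hs2 : s ^ 2 * (s ^ i)⁻¹ ≤ 1 := by
        rw [← div_eq_mul_inv, div_le_one (by positivity)]
        exact pow_le_pow_of_le_one hs.le hs1 hi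
      have h2 : (2 : ℝ) ^ i ≤ 4 := by
        calc (2 : ℝ) ^ i ≤ 2 ^ 2 := pow_le_pow_right₀ one_le_two hi
          _ = 4 := by norm_num
      calc _ ≤ ∑ j ∈ Finset.range (i + 1), (i.choose j : ℝ) * (B * c) := by
            refine Finset.sum_le_sum fun j hj => ?_
            have hj : j ≤ i := Nat.lt_succ_iff.1 (Finset.mem_range.1 hj)
            rw [mul_assoc]
            refine mul_le_mul_of_nonneg_left ?_ (by positivity)
            calc _ ≤ (B * (s ^ j)⁻¹) * (c * s ^ 2 * (s ^ (i - j))⁻¹) :=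
                  mul_le_mul (hχb x y j (by omega)) (hw x hx y hy _ (by omega))
                    (norm_nonneg _) (by positivity)
              _ = B * c * (s ^ 2 * (s ^ i)⁻¹) := by
                  rw [← pow_mul_pow_sub s hj, mul_inv]; ring
              _ ≤ B * c * 1 := by gcongr
              _ = _ := mul_one _
        _ = 2 ^ i * (B * c) := by
            rw [← Finset.sum_mul]
            congr 1
            exact_mod_cast Nat.sum_range_choose i
        _ ≤ 4 * (B * c) := by gcongr
        _ = _ := by ring
  refine ⟨fun y => v y + ∑ x ∈ A, t x y, fun y => ?_, fun x hx => ?_,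
    hv.1.add (ContDiff.sum htc), fun y i hi => ?_⟩
  · obtain ⟨x, hx, hxz⟩ := hnear y
    beta_reduce
    rw [Finset.sum_eq_single_of_mem x hx fun z hz hzx => by
      simp only [ht, hχy z y (hxz z hz hzx), zero_mul]]
    have h1 := mul_nonneg (hχ0 x y) (hφ0 x hx y)
    have h2 := mul_nonneg (sub_nonneg.2 (hχle x y)) (hv0 y)
    simp only [ht, hwdef]
    linarith
  · beta_reduce
    rw [Finset.sum_eq_single_of_mem x hx fun z hz hzx => by
      simp only [ht]
      rw [hχy z x (by linarith [hsep z hz x hx hzx]), zero_mul]]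
    simp only [ht, hwdef, hχ1]
    ring
  · obtain ⟨x, hx, hxz⟩ := hnear y
    have e : (fun y => v y + ∑ x ∈ A, t x y) = v + fun y => ∑ x ∈ A, t x y := rfl
    have hci := hcast i hi
    rw [e, iteratedFDeriv_add_apply (hv.1.of_le hci).contDiffAt
      ((ContDiff.sum htc).of_le hci).contDiffAt,
      iteratedFDeriv_sum fun z hz => (htc z hz).of_le hci, Finset.sum_apply,
      Finset.sum_eq_single_of_mem x hx fun z hz hzx => htz z hz y (hxz z hz hzx) i hi]
    exact (norm_add_le _ _).trans (add_le_add (hv.2 y i hi) (htb x hx y i hi))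

/-- The nonnegative Whitney extension theorem for finite sets, at unit scale. -/
theorem IsWhitneyJet.exists_extension_of_one : ∃ C : ℝ, 0 < C ∧
    ∀ (A : Finset E2) (f : E2 → ℝ) (g : E2 → E2), A.Nonempty → IsWhitneyJet A f g 1 →
      ∃ F : E2 → ℝ, (∀ y, 0 ≤ F y) ∧ (∀ x ∈ A, F x = f x) ∧ C2BddBy F C := by
  obtain ⟨B, hB, hglue⟩ := exists_glue
  refine ⟨24 + B * 160, by positivity, fun A f g hA hj => ?_⟩
  obtain ⟨s, hs, hs1, hsep⟩ := A.exists_separation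
  set φ : E2 → E2 → ℝ := fun x y => f x + inner ℝ (g x) (y - x) + 4 * ‖y - x‖ ^ 2 with hφ
  have hφc : ∀ x, ContDiff ℝ 2 (φ x) := fun x => by
    have : ContDiff ℝ 2 fun y : E2 => ‖y - x‖ ^ 2 := (contDiff_id.sub contDiff_const).norm_sq ℝ
    exact (contDiff_const.add (contDiff_const.inner ℝ (contDiff_id.sub contDiff_const))).add
      (contDiff_const.mul this)
  have hφs : ∀ x y h, φ x (y + h) + φ x (y - h) - 2 * φ x y = 2 * 4 * ‖h‖ ^ 2 := fun x y h => by
    have := parallelogram_law_with_norm ℝ (y - x) h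
    have e1 : y + h - x = y - x + h := by abel
    have e2 : y - h - x = y - x - h := by abel
    simp only [hφ, e1, e2, inner_add_right, inner_sub_right (g x) (y - x) h]
    linarith
  have hφS : ∀ x, SecondDiffBdd (φ x) 4 := fun x y h => by
    rw [hφs, abs_of_nonneg (by positivity)]
  have hlin : ∀ x ∈ A, ∀ v : E2, |inner ℝ (g x) v| ≤ √(f x) * ‖v‖ := fun x hx v => by
    refine (abs_real_inner_le_norm _ _).trans (mul_le_mul_of_nonneg_right ?_ (norm_nonneg v))
    have := hj.slope_sq_le x hx
    rw [one_mul] at this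
    exact Real.le_sqrt_of_sq_le this
  have hφ0 : ∀ x ∈ A, ∀ y, 0 ≤ φ x y := fun x hx y => by
    have h1 := (abs_le.1 (hlin x hx (y - x))).1
    have h2 := Real.sq_sqrt (hj.value_nonneg x hx)
    simp only [hφ]
    nlinarith [sq_nonneg (√(f x) - ‖y - x‖), sq_nonneg ‖y - x‖, sq_nonneg (√(f x))]
  obtain ⟨u, hum, huS, hu0, huq, hul⟩ := exists_secondDiffBdd_between (K := 4)
    (𝒬 := insert (fun _ => 2) (φ '' A)) ⟨_, Set.mem_insert _ _⟩ (by norm_num)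
    (by
      rintro q (rfl | ⟨x, hx, rfl⟩) y
      · norm_num
      · exact hφ0 x hx y)
    (by
      rintro q (rfl | ⟨x, hx, rfl⟩) y h
      · norm_num
      · exact (hφs x y h).le)
  have hlow : ∀ x ∈ A, ∀ y, φ x y - 8 * ‖y - x‖ ^ 2 ≤ u y := fun x hx => by
    have e : ∀ y, φ x y - 8 * ‖y - x‖ ^ 2 =
        inner ℝ (g x + (8 : ℝ) • x) y + (f x - inner ℝ (g x) x - 4 * ‖x‖ ^ 2) - 4 * ‖y‖ ^ 2 :=
      fun y => by
        have := norm_sub_sq_real y x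
        simp only [hφ, inner_add_left, inner_smul_left, conj_trivial, inner_sub_right]
        rw [this, real_inner_comm x y]
        ring
    intro y
    rw [e]
    refine hul _ _ ?_ y
    rintro q (rfl | ⟨z, hz, rfl⟩) y
    · rw [← e]
      have h1 := real_inner_le_norm (g x) (y - x)
      have h2 := mul_le_mul_of_nonneg_right (hj.slope_le x hx) (norm_nonneg (y - x))
      have h3 := hj.value_le x hx
      simp only [hφ]
      nlinarith [sq_nonneg (‖y - x‖ - 1)]
    · rw [← e]
      have h1 := (abs_le.1 (hj.taylor x hx z hz)).1
      have h2 := abs_real_inner_le_norm (g z - g x) (y - z)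
      have h3 := mul_le_mul_of_nonneg_right (hj.slope_sub_le x hx z hz) (norm_nonneg (y - z))
      have h4 := norm_sub_le (y - x) (y - z)
      rw [sub_sub_sub_cancel_left] at h4
      have h5 := (abs_le.1 (h2.trans h3)).1
      have e2 : inner ℝ (g z - g x) (y - z) = inner ℝ (g z) (y - z) - inner ℝ (g x) (y - x) +
          inner ℝ (g x) (z - x) := by
        have : y - z = (y - x) - (z - x) := by abel
        rw [inner_sub_left]
        conv_lhs => rw [this]
        rw [inner_sub_right (g x)]
        rw [← this]
        ring
      rw [e2] at h5
      simp only [hφ]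
      have := norm_nonneg (z - x)
      have := norm_nonneg (y - z)
      have := norm_nonneg (y - x)
      have h6 : ‖z - x‖ ^ 2 ≤ (‖y - x‖ + ‖y - z‖) ^ 2 := by gcongr
      have h7 := mul_le_mul_of_nonneg_right h4 (norm_nonneg (y - z))
      nlinarith [sq_nonneg (‖y - x‖ - ‖y - z‖)]
  obtain ⟨v, hvc, hvS, hv0, hv2, hvu⟩ := huS.exists_contDiff_approx hum hu0
    (fun y => huq _ (Set.mem_insert _ _) y) hs
  have hvd : Differentiable ℝ v := hvc.differentiable (by norm_num)
  have hvB : C2BddBy v 24 := by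
    refine ⟨hvc, fun y i hi => ?_⟩
    interval_cases i
    · rw [norm_iteratedFDeriv_zero, Real.norm_of_nonneg (hv0 y)]
      linarith [hv2 y]
    · have := hvS.norm_iteratedFDeriv_one_le (hvd y) one_pos zero_le_two fun z _ =>
        abs_le.2 ⟨by linarith [hv0 z, hv2 y], by linarith [hv2 z, hv0 y]⟩
      linarith
    · have := hvS.norm_iteratedFDeriv_two_le hvd y
      linarith
  have hclose : ∀ x ∈ A, ∀ y, ‖y - x‖ ≤ 3 * s → |φ x y - v y| ≤ 76 * s ^ 2 := fun x hx y hy => by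
    have h1 := abs_le.1 (hvu y)
    have h2 := hlow x hx y
    have h3 := huq _ (Set.mem_insert_of_mem _ ⟨x, hx, rfl⟩) y
    have h4 : ‖y - x‖ ^ 2 ≤ (3 * s) ^ 2 := by gcongr
    exact abs_le.2 ⟨by nlinarith, by nlinarith⟩
  obtain ⟨F, hF0, hFf, hF⟩ := hglue A v φ s 160 24 hA hs hs1 hsep hvB (fun x _ => hφc x) hv0 hφ0
    (by norm_num) fun x hx y hy i hi => by
      have hS := (hφS x).sub hvS
      have hd : Differentiable ℝ fun y => φ x y - v y :=
        ((hφc x).sub hvc).differentiable (by norm_num)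
      interval_cases i
      · rw [norm_iteratedFDeriv_zero, Real.norm_eq_abs]
        refine (hclose x hx y (by linarith)).trans ?_
        simp only [pow_zero, inv_one, mul_one]
        gcongr
        norm_num
      · have hcy := abs_le.1 (hclose x hx y (by linarith))
        have := hS.norm_iteratedFDeriv_one_le (hd y) hs (m := 152 * s ^ 2) (by positivity)
          fun z hz => by
            have h1 := norm_add_le (z - y) (y - x)
            rw [sub_add_sub_cancel] at h1
            have hcz := abs_le.1 (hclose x hx z (by linarith))
            exact abs_le.2 ⟨by linarith, by linarith⟩
        refine this.trans (le_of_eq ?_)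
        field_simp
        norm_num
      · refine (hS.norm_iteratedFDeriv_two_le hd y).trans ?_
        rw [mul_assoc, mul_inv_cancel₀ (by positivity)]
        norm_num
  refine ⟨F, hF0, fun x hx => (hFf x hx).trans ?_, hF⟩
  simp [hφ]

theorem IsWhitneyJet.smul {A : Finset E2} {f : E2 → ℝ} {g : E2 → E2} {M c : ℝ}
    (h : IsWhitneyJet A f g M) (hc : 0 ≤ c) :
    IsWhitneyJet A (fun x => c * f x) (fun x => c • g x) (c * M) where
  value_nonneg x hx := mul_nonneg hc (h.value_nonneg x hx)
  value_le x hx := mul_le_mul_of_nonneg_left (h.value_le x hx) hc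
  slope_le x hx := by
    rw [norm_smul, Real.norm_of_nonneg hc]
    exact mul_le_mul_of_nonneg_left (h.slope_le x hx) hc
  slope_sq_le x hx := by
    rw [norm_smul, Real.norm_of_nonneg hc, mul_pow]
    have := mul_le_mul_of_nonneg_left (h.slope_sq_le x hx) (sq_nonneg c)
    linarith
  slope_sub_le x hx y hy := by
    rw [← smul_sub, norm_smul, Real.norm_of_nonneg hc, mul_assoc]
    exact mul_le_mul_of_nonneg_left (h.slope_sub_le x hx y hy) hc
  taylor x hx y hy := by
    have e : c * f y - c * f x - inner ℝ (c • g x) (y - x) =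
        c * (f y - f x - inner ℝ (g x) (y - x)) := by
      rw [inner_smul_left]; simp only [conj_trivial]; ring
    rw [e, abs_mul, abs_of_nonneg hc, mul_assoc]
    exact mul_le_mul_of_nonneg_left (h.taylor x hx y hy) hc

/-- The nonnegative Whitney extension theorem for finite sets. -/
theorem IsWhitneyJet.exists_extension : ∃ C : ℝ, 0 < C ∧
    ∀ (A : Finset E2) (f : E2 → ℝ) (g : E2 → E2) (M : ℝ), A.Nonempty → 0 < M →
      IsWhitneyJet A f g M →
      ∃ F : E2 → ℝ, (∀ y, 0 ≤ F y) ∧ (∀ x ∈ A, F x = f x) ∧ C2BddBy F (C * M) := by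
  obtain ⟨C, hC, h⟩ := exists_extension_of_one
  refine ⟨C, hC, fun A f g M hA hM hj => ?_⟩
  have hj' := hj.smul (inv_nonneg.2 hM.le)
  rw [inv_mul_cancel₀ hM.ne'] at hj'
  obtain ⟨F, hF0, hFf, hF⟩ := h A _ _ hA hj'
  refine ⟨fun y => M * F y, fun y => mul_nonneg hM.le (hF0 y), fun x hx => ?_, ?_⟩
  · simp only [hFf x hx]
    rw [mul_inv_cancel_left₀ hM.ne']
  · have := hF.const_mul M
    rwa [abs_of_pos hM, mul_comm] at this

theorem posTraceNorm_nonneg (S : Set E2) (f : E2 → ℝ) : 0 ≤ posTraceNorm S f :=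
  Real.sInf_nonneg fun _ hM => hM.1

theorem posTraceNorm_le {S : Set E2} {f F : E2 → ℝ} {M : ℝ} (h0 : ∀ y, 0 ≤ F y)
    (hF : ∀ x ∈ S, F x = f x) (hM : C2BddBy F M) : posTraceNorm S f ≤ M :=
  csInf_le ⟨0, fun _ h => h.1⟩ ⟨hM.nonneg, F, h0, hF, hM⟩

theorem posTraceNorm_empty (f : E2 → ℝ) : posTraceNorm ∅ f = 0 :=
  (posTraceNorm_le (F := fun _ => 0) (fun _ => le_rfl) (by simp) C2BddBy.zero).antisymm
    (posTraceNorm_nonneg _ _)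

/-- A nonnegative function on a finite set has a nonnegative bounded smooth extension. -/
theorem exists_nonneg_extension (A : Finset E2) {f : E2 → ℝ} (hf : ∀ x ∈ A, 0 ≤ f x) :
    ∃ (M : ℝ) (F : E2 → ℝ), (∀ y, 0 ≤ F y) ∧ (∀ x ∈ A, F x = f x) ∧ C2BddBy F M := by
  rcases A.eq_empty_or_nonempty with rfl | hA
  · exact ⟨0, fun _ => 0, fun _ => le_rfl, by simp, C2BddBy.zero⟩
  obtain ⟨B, -, h⟩ := exists_glue
  obtain ⟨s, hs, hs1, hsep⟩ := A.exists_separation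
  have hc : 0 ≤ ∑ x ∈ A, f x := Finset.sum_nonneg hf
  refine ⟨_, h A (fun _ => 0) (fun x _ => f x) s ((∑ x ∈ A, f x) / s ^ 2) 0 hA hs hs1 hsep
    C2BddBy.zero (fun x _ => contDiff_const) (fun _ => le_rfl) (fun x hx _ => hf x hx)
    (by positivity) fun x hx y _ i _ => ?_⟩
  rcases i with _ | i
  · rw [norm_iteratedFDeriv_zero, sub_zero, Real.norm_of_nonneg (hf x hx),
      div_mul_cancel₀ _ (by positivity), pow_zero, inv_one, mul_one]
    exact Finset.single_le_sum hf hx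
  · rw [iteratedFDeriv_const_of_ne (by omega)]
    simp only [Pi.zero_apply, norm_zero]
    positivity

theorem posTraceNorm_mono {S E : Set E2} (hE : E.Finite) (hSE : S ⊆ E) {f : E2 → ℝ}
    (hf : ∀ x ∈ E, 0 ≤ f x) : posTraceNorm S f ≤ posTraceNorm E f := by
  lift E to Finset E2 using hE
  obtain ⟨M, F, h0, hF, hM⟩ := exists_nonneg_extension E hf
  refine csInf_le_csInf ⟨0, fun _ h => h.1⟩ ⟨M, hM.nonneg, F, h0, hF, hM⟩ ?_
  rintro M' ⟨hM', F', h0', hF', hb⟩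
  exact ⟨hM', F', h0', fun x hx => hF' x (hSE hx), hb⟩

theorem exists_of_posTraceNorm_lt {S : Set E2} (hS : S.Finite) {f : E2 → ℝ}
    (hf : ∀ x ∈ S, 0 ≤ f x) {M : ℝ} (hM : posTraceNorm S f < M) :
    ∃ F : E2 → ℝ, (∀ y, 0 ≤ F y) ∧ (∀ x ∈ S, F x = f x) ∧ C2BddBy F M := by
  lift S to Finset E2 using hS
  obtain ⟨M₀, F₀, h0, hF, hM₀⟩ := exists_nonneg_extension S hf
  have hne : {M : ℝ | 0 ≤ M ∧ ∃ F : E2 → ℝ, (∀ y, 0 ≤ F y) ∧ (∀ x ∈ (S : Set E2), F x = f x) ∧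
      C2BddBy F M}.Nonempty := ⟨M₀, hM₀.nonneg, F₀, h0, hF, hM₀⟩
  obtain ⟨M', ⟨-, F', h0', hF', hb⟩, hlt⟩ := exists_lt_of_csInf_lt hne hM
  exact ⟨F', h0', hF', hb.mono hlt.le⟩

/-- Sharp Finiteness Principle: a list of at most `C₄·N` subsets
of size at most `C₃` whose trace norms control the full trace norm. -/
theorem statement2 :
    ∃ (C₃ C₄ : ℕ) (C₅ : ℝ), 0 < C₅ ∧
      ∀ E : Set E2, E.Finite →
        ∃ (L : ℕ) (S : Fin L → Set E2),
          (∀ ℓ, S ℓ ⊆ E ∧ (S ℓ).ncard ≤ C₃) ∧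
          L ≤ C₄ * E.ncard ∧
          ∀ f : E2 → ℝ, (∀ x ∈ E, 0 ≤ f x) →
            (∀ ℓ, posTraceNorm (S ℓ) f ≤ posTraceNorm E f) ∧
            posTraceNorm E f ≤ C₅ * ⨆ ℓ, posTraceNorm (S ℓ) f := by
  obtain ⟨k, hk⟩ := exists_isWhitneyJet
  obtain ⟨C, hC, hext⟩ := IsWhitneyJet.exists_extension
  refine ⟨12, k + 1, 1 + C * 4800, by positivity, fun E hE => ?_⟩
  lift E to Finset E2 using hE
  rw [Set.ncard_coe_finset]
  rcases Nat.lt_or_ge E.card 2 with hlt | hcard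
  · obtain h | h : E.card = 0 ∨ E.card = 1 := by omega
    · refine ⟨0, Fin.elim0, fun ℓ => ℓ.elim0, Nat.zero_le _, fun f _ => ⟨fun ℓ => ℓ.elim0, ?_⟩⟩
      rw [Finset.card_eq_zero.1 h, Finset.coe_empty, posTraceNorm_empty, Real.iSup_of_isEmpty,
        mul_zero]
    · refine ⟨1, fun _ => E, fun _ => ⟨subset_rfl, ?_⟩, by rw [h]; omega, fun f _ =>
        ⟨fun _ => le_rfl, ?_⟩⟩
      · rw [Set.ncard_coe_finset]; omega
      · rw [ciSup_const]
        have h1 := posTraceNorm_nonneg E f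
        have h2 := mul_nonneg (mul_nonneg hC.le (by norm_num : (0 : ℝ) ≤ 4800)) h1
        linarith
  obtain ⟨T, S, hT, hS, hjet⟩ := hk E hcard
  refine ⟨T.card, fun ℓ => S (T.equivFin.symm ℓ), fun ℓ => ?_, hT.trans ?_, fun f hf =>
    ⟨fun ℓ => ?_, ?_⟩⟩
  · have := hS _ (T.equivFin.symm ℓ).2
    rw [Set.ncard_coe_finset]
    exact ⟨Finset.coe_subset.2 this.1, this.2⟩
  · exact Nat.mul_le_mul_right _ (Nat.le_succ k)
  · exact posTraceNorm_mono E.finite_toSet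
      (Finset.coe_subset.2 (hS _ (T.equivFin.symm ℓ).2).1) hf
  · set m := ⨆ ℓ, posTraceNorm (S (T.equivFin.symm ℓ)) f with hm
    have hm0 : 0 ≤ m := Real.iSup_nonneg fun ℓ => posTraceNorm_nonneg _ _
    have key : ∀ M, m < M → posTraceNorm E f ≤ C * 4800 * M := fun M hM => by
      obtain ⟨g, hg⟩ := hjet f M fun q hq => by
        refine exists_of_posTraceNorm_lt (S := S q) (S q).finite_toSet
          (fun x hx => hf x ((hS q hq).1 hx)) (lt_of_le_of_lt ?_ hM)
        have := le_ciSup (f := fun ℓ => posTraceNorm (S (T.equivFin.symm ℓ)) f)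
          (Set.finite_range _).bddAbove (T.equivFin ⟨q, hq⟩)
        simpa using this
      obtain ⟨F, h0, hF, hb⟩ := hext E f g (4800 * M) (Finset.card_pos.1 (by omega))
        (by linarith) hg
      refine (posTraceNorm_le h0 hF hb).trans (le_of_eq (by ring))
    have hle : posTraceNorm E f ≤ C * 4800 * m := by
      refine le_of_forall_pos_le_add fun ε hε => ?_
      refine (key (m + ε / (C * 4800)) (by linarith [show 0 < ε / (C * 4800) by positivity])).trans
        (le_of_eq ?_)
      field_simp
    linarith
end

section
/- For every N₀ ∈ ℕ there exists a constant C, depending only on N₀, such that for every finite set S ⊂ ℝ² with #S ≤ N₀ and every f : S → [0,∞): C⁻¹·‖f‖_{C²₊(S)} ≤ inf{ (𝒬_S + ℳ_S)(P⃗) : P⃗ = (P^x)_{x∈S} a Whitney field on S with P^x(x) = f(x) for all x ∈ S } ≤ C·‖f‖_{C²₊(S)}. -/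
open scoped Classical ENNReal

/-- An affine polynomial on `ℝ²`, represented by its constant term and linear
part: `P(y) = P.1 + P.2 y`. -/
abbrev AffPoly := ℝ × (E2 →L[ℝ] ℝ)

/-- Evaluation of an affine polynomial. -/
def evalA (P : AffPoly) (y : E2) : ℝ := P.1 + P.2 y

/-- The functional `𝒬_S`. -/
noncomputable def QS (S : Finset E2) (P : E2 → AffPoly) : ℝ :=
  (∑ x ∈ S, (|evalA (P x) x| + ‖(P x).2‖)) +
  ∑ x ∈ S, ∑ y ∈ S, if x = y then 0 else
    (|evalA (P x) x - evalA (P y) x| / dist x y ^ 2 +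
      ‖(P x).2 - (P y).2‖ / dist x y)

/-- The functional `ℳ_S`, with values in `[0,∞]`, with conventions `0/0 = 0`
and `a/0 = ∞` for `a > 0`. -/
noncomputable def MS (S : Finset E2) (P : E2 → AffPoly) : ℝ≥0∞ :=
  if ∀ x ∈ S, 0 ≤ evalA (P x) x then
    ∑ x ∈ S, ENNReal.ofReal (‖(P x).2‖ ^ 2) / ENNReal.ofReal (evalA (P x) x)
  else ⊤

section JetBounds

variable {E : Type*} [NormedAddCommGroup E] [InnerProductSpace ℝ E]

/-- `f` is `C²` and its derivatives of order `i ≤ 2` at `y` are at most `B * r ^ i`. -/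
def JetBound (f : E → ℝ) (y : E) (B r : ℝ) : Prop :=
  ContDiff ℝ 2 f ∧ ∀ i : ℕ, i ≤ 2 → ‖iteratedFDeriv ℝ i f y‖ ≤ B * r ^ i

theorem norm_iteratedFDeriv_two (f : E → ℝ) (y : E) :
    ‖iteratedFDeriv ℝ 2 f y‖ = ‖fderiv ℝ (fderiv ℝ f) y‖ := by
  rw [← norm_iteratedFDeriv_fderiv (n := 1), norm_iteratedFDeriv_one]

theorem jetBound_of_fderiv {f : E → ℝ} {y : E} {B r : ℝ} (hf : ContDiff ℝ 2 f)
    (h0 : |f y| ≤ B) (h1 : ‖fderiv ℝ f y‖ ≤ B * r)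
    (h2 : ‖fderiv ℝ (fderiv ℝ f) y‖ ≤ B * r ^ 2) : JetBound f y B r := by
  refine ⟨hf, fun i hi => ?_⟩
  interval_cases i
  · simpa [norm_iteratedFDeriv_zero] using h0
  · simpa [norm_iteratedFDeriv_one] using h1
  · simpa [norm_iteratedFDeriv_two] using h2

namespace JetBound

variable {f g : E → ℝ} {y : E} {B B₁ B₂ r : ℝ}

theorem abs_le (h : JetBound f y B r) : |f y| ≤ B := by
  simpa [norm_iteratedFDeriv_zero] using h.2 0 (by norm_num)

theorem nonneg (h : JetBound f y B r) : 0 ≤ B := (abs_nonneg _).trans h.abs_le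

theorem fderiv_le (h : JetBound f y B r) : ‖fderiv ℝ f y‖ ≤ B * r := by
  simpa [norm_iteratedFDeriv_one] using h.2 1 (by norm_num)

theorem mono (h : JetBound f y B₁ r) (hB : B₁ ≤ B₂) (hr : 0 ≤ r) : JetBound f y B₂ r :=
  ⟨h.1, fun i hi => (h.2 i hi).trans (by gcongr)⟩

theorem const (c : ℝ) (hr : 0 ≤ r) : JetBound (fun _ : E => c) y |c| r := by
  have h : fderiv ℝ (fun _ : E => c) = fun _ => 0 := by ext; simp
  refine jetBound_of_fderiv contDiff_const le_rfl ?_ ?_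
  · rw [h, norm_zero]; positivity
  · rw [h, fderiv_fun_const, Pi.zero_apply]
    exact ContinuousLinearMap.opNorm_zero.le.trans (by positivity)

theorem add (hf : JetBound f y B₁ r) (hg : JetBound g y B₂ r) :
    JetBound (fun z => f z + g z) y (B₁ + B₂) r := by
  refine ⟨hf.1.add hg.1, fun i hi => ?_⟩
  have hi' : (i : WithTop ℕ∞) ≤ 2 := by exact_mod_cast hi
  have hfg : (fun z => f z + g z) = f + g := rfl
  rw [hfg, iteratedFDeriv_add_apply (hf.1.of_le hi').contDiffAt (hg.1.of_le hi').contDiffAt]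
  calc _ ≤ _ := norm_add_le _ _
    _ ≤ B₁ * r ^ i + B₂ * r ^ i := add_le_add (hf.2 i hi) (hg.2 i hi)
    _ = _ := by ring

theorem neg (hf : JetBound f y B r) : JetBound (fun z => - f z) y B r := by
  refine ⟨hf.1.neg, fun i hi => ?_⟩
  have : (fun z => - f z) = -f := rfl
  rw [this, iteratedFDeriv_neg_apply, norm_neg]
  exact hf.2 i hi

theorem sum {ι : Type*} {s : Finset ι} {f : ι → E → ℝ} {B : ι → ℝ} (hr : 0 ≤ r)
    (h : ∀ i ∈ s, JetBound (f i) y (B i) r) :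
    JetBound (fun z => ∑ i ∈ s, f i z) y (∑ i ∈ s, B i) r := by
  induction s using Finset.induction_on with
  | empty => simpa using const (E := E) (y := y) 0 hr
  | insert a s ha ih =>
    simp only [Finset.sum_insert ha]
    exact (h a (by simp)).add (ih fun i hi => h i (by simp [hi]))

theorem mul (hf : JetBound f y B₁ r) (hg : JetBound g y B₂ r) :
    JetBound (fun z => f z * g z) y (4 * (B₁ * B₂)) r := by
  refine ⟨hf.1.mul hg.1, fun i hi => ?_⟩
  have hi' : (i : WithTop ℕ∞) ≤ 2 := by exact_mod_cast hi
  refine (norm_iteratedFDeriv_mul_le hf.1 hg.1 y hi').trans ?_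
  have key : ∀ j ∈ Finset.range (i + 1),
      (i.choose j : ℝ) * ‖iteratedFDeriv ℝ j f y‖ * ‖iteratedFDeriv ℝ (i - j) g y‖ ≤
        i.choose j * (B₁ * B₂ * r ^ i) := by
    intro j hj
    have hj' : j ≤ i := by simpa [Nat.lt_succ_iff] using hj
    have h1 := hf.2 j (hj'.trans hi)
    have h2 := hg.2 (i - j) ((Nat.sub_le _ _).trans hi)
    calc _ = (i.choose j : ℝ) *
          (‖iteratedFDeriv ℝ j f y‖ * ‖iteratedFDeriv ℝ (i - j) g y‖) := by ring
      _ ≤ i.choose j * ((B₁ * r ^ j) * (B₂ * r ^ (i - j))) := by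
          gcongr
          exact (norm_nonneg _).trans h1
      _ = i.choose j * (B₁ * B₂ * (r ^ j * r ^ (i - j))) := by ring
      _ = _ := by rw [← pow_add, Nat.add_sub_cancel' hj']
  have hB : 0 ≤ B₁ * B₂ * r ^ i := by
    have h1 := (norm_nonneg _).trans (hf.2 i hi)
    have := mul_nonneg h1 hg.nonneg
    linarith [this, mul_right_comm B₁ B₂ (r ^ i)]
  refine (Finset.sum_le_sum key).trans ?_
  rw [← Finset.sum_mul]
  have h4 : (∑ j ∈ Finset.range (i + 1), (i.choose j : ℝ)) ≤ 4 := by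
    have := Nat.sum_range_choose i
    have h2 : (∑ j ∈ Finset.range (i + 1), (i.choose j : ℝ)) = 2 ^ i := by exact_mod_cast this
    rw [h2]
    interval_cases i <;> norm_num
  calc _ ≤ 4 * (B₁ * B₂ * r ^ i) := by gcongr
    _ = _ := by ring

theorem prod {ι : Type*} {s : Finset ι} {f : ι → E → ℝ} {K : ℝ} {b : ι → ℝ} (hr : 0 ≤ r)
    (h : ∀ i ∈ s, JetBound (f i) y (K * b i) r) :
    JetBound (fun z => ∏ i ∈ s, f i z) y ((4 * K) ^ s.card * ∏ i ∈ s, b i) r := by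
  induction s using Finset.induction_on with
  | empty => simpa using const (E := E) (y := y) 1 hr
  | insert a s ha ih =>
    simp only [Finset.prod_insert ha, Finset.card_insert_of_notMem ha]
    have := (h a (by simp)).mul (ih fun i hi => h i (by simp [hi]))
    convert this using 1
    ring

theorem inv {K : ℝ} (hK : 1 ≤ K) (hr : 0 ≤ r) (hpos : ∀ z, 0 < f z)
    (hf : JetBound f y (K * f y) r) :
    JetBound (fun z => (f z)⁻¹) y (3 * K ^ 2 * (f y)⁻¹) r := by
  have hc : ContDiff ℝ 2 (fun z => (f z)⁻¹) := hf.1.inv fun z => (hpos z).ne'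
  have hd : Differentiable ℝ f := hf.1.differentiable (by norm_num)
  have hfd : fderiv ℝ (fun z => (f z)⁻¹) = fun z => (-((f z)⁻¹ * (f z)⁻¹)) • fderiv ℝ f z := by
    funext z
    have := ((hasDerivAt_inv (hpos z).ne').comp_hasFDerivAt z (hd z).hasFDerivAt).fderiv
    rw [show (fun z => (f z)⁻¹) = Inv.inv ∘ f from rfl, this]
    congr 1
    rw [pow_two, mul_inv]
  have hy := hpos y
  have hu : 0 < (f y)⁻¹ := inv_pos.2 hy
  have huf : (f y)⁻¹ * f y = 1 := inv_mul_cancel₀ hy.ne'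
  have hfd1 : ‖fderiv ℝ (fun z => (f z)⁻¹) y‖ ≤ K * (f y)⁻¹ * r := by
    rw [hfd]
    simp only [norm_smul, norm_neg, norm_mul, Real.norm_eq_abs, abs_of_pos hu]
    calc _ ≤ (f y)⁻¹ * (f y)⁻¹ * (K * f y * r) := by gcongr; exact hf.fderiv_le
      _ = ((f y)⁻¹ * f y) * (K * (f y)⁻¹ * r) := by ring
      _ = _ := by rw [huf, one_mul]
  have hfd2 : ‖fderiv ℝ (fderiv ℝ f) y‖ ≤ K * f y * r ^ 2 := by
    simpa [norm_iteratedFDeriv_two] using hf.2 2 le_rfl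
  refine jetBound_of_fderiv hc ?_ ?_ ?_
  · rw [abs_of_pos hu]
    nlinarith
  · refine hfd1.trans ?_
    gcongr
    nlinarith
  · have du : DifferentiableAt ℝ (fun z => (f z)⁻¹) y := hc.differentiable (by norm_num) y
    have ddf : DifferentiableAt ℝ (fderiv ℝ f) y :=
      (hf.1.fderiv_right (m := 1) (by norm_num)).differentiable (by norm_num) y
    have h2 := ((du.hasFDerivAt.mul du.hasFDerivAt).neg.smul ddf.hasFDerivAt).fderiv
    rw [hfd]
    have h3 : (fun z => (-((f z)⁻¹ * (f z)⁻¹)) • fderiv ℝ f z) =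
      (-((fun z => (f z)⁻¹) * (fun z => (f z)⁻¹))) • fderiv ℝ f := rfl
    rw [h3, h2]
    refine (ContinuousLinearMap.opNorm_add_le _ _).trans ?_
    set u := (f y)⁻¹ with hu_def
    have e1 : ‖(-((fun z => (f z)⁻¹) * (fun z => (f z)⁻¹))) y • fderiv ℝ (fderiv ℝ f) y‖ ≤
        K * u * r ^ 2 := by
      refine (ContinuousLinearMap.opNorm_smul_le _ _).trans ?_
      simp only [Pi.neg_apply, Pi.mul_apply, norm_neg, norm_mul, Real.norm_eq_abs,
        ← hu_def, abs_of_pos hu]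
      calc _ ≤ u * u * (K * f y * r ^ 2) := by gcongr
        _ = (u * f y) * (K * u * r ^ 2) := by ring
        _ = _ := by rw [huf, one_mul]
    have e2 : ‖(-(u • fderiv ℝ (fun z => (f z)⁻¹) y + u • fderiv ℝ (fun z => (f z)⁻¹) y)
        ).smulRight (fderiv ℝ f y)‖ ≤ 2 * K ^ 2 * u * r ^ 2 := by
      rw [ContinuousLinearMap.norm_smulRight_apply, norm_neg]
      calc _ ≤ (u * (K * u * r) + u * (K * u * r)) * (K * f y * r) := by
            gcongr
            · refine (norm_add_le _ _).trans ?_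
              rw [norm_smul, Real.norm_eq_abs, abs_of_pos hu]
              gcongr
            · exact hf.fderiv_le
        _ = (u * f y) * (2 * K ^ 2 * u * r ^ 2) := by ring
        _ = _ := by rw [huf, one_mul]
    calc _ ≤ K * u * r ^ 2 + 2 * K ^ 2 * u * r ^ 2 := add_le_add e1 e2
      _ ≤ K ^ 2 * u * r ^ 2 + 2 * K ^ 2 * u * r ^ 2 := by gcongr; nlinarith
      _ = _ := by ring

end JetBound

/-- The jet of a quadratic polynomial with scalar Hessian. -/
theorem jetBound_quadratic (c a : ℝ) (g : E →L[ℝ] ℝ) (x y : E) {B r : ℝ}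
    (h0 : |c + g (y - x) + a * ‖y - x‖ ^ 2| ≤ B)
    (h1 : ‖g‖ + 2 * |a| * ‖y - x‖ ≤ B * r) (h2 : 2 * |a| ≤ B * r ^ 2) :
    JetBound (fun z => c + g (z - x) + a * ‖z - x‖ ^ 2) y B r := by
  have hc : ContDiff ℝ 2 (fun z => c + g (z - x) + a * ‖z - x‖ ^ 2) :=
    (contDiff_const.add (g.contDiff.comp (contDiff_id.sub contDiff_const))).add
      (contDiff_const.mul ((contDiff_id.sub contDiff_const).norm_sq ℝ))
  have hfd : fderiv ℝ (fun z => c + g (z - x) + a * ‖z - x‖ ^ 2) =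
      fun z => g + (2 * a) • innerSL ℝ (z - x) := by
    funext z
    have hz : HasFDerivAt (fun z : E => z - x) (ContinuousLinearMap.id ℝ E) z :=
      (hasFDerivAt_id z).sub_const x
    have := (((g.hasFDerivAt.comp z hz).const_add c).add (hz.norm_sq.const_mul a)).fderiv
    refine Eq.trans this ?_
    ext v
    simp
    ring
  have hfd2 : fderiv ℝ (fun z : E => g + (2 * a) • innerSL ℝ (z - x)) y =
      (2 * a) • (innerSL ℝ : E →L[ℝ] E →L[ℝ] ℝ) := by
    have hz : HasFDerivAt (fun z : E => z - x) (ContinuousLinearMap.id ℝ E) y :=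
      (hasFDerivAt_id y).sub_const x
    exact ((((innerSL ℝ : E →L[ℝ] E →L[ℝ] ℝ).hasFDerivAt.comp y hz).const_smul
      (2 * a)).const_add g).fderiv
  have hn : ‖(innerSL ℝ : E →L[ℝ] E →L[ℝ] ℝ)‖ ≤ 1 := norm_innerSL_le ℝ
  have habs : |2 * a| = 2 * |a| := by simp [abs_mul]
  refine jetBound_of_fderiv hc h0 ?_ ?_
  · rw [hfd]
    refine (norm_add_le _ _).trans (le_trans ?_ h1)
    rw [norm_smul, innerSL_apply_norm, Real.norm_eq_abs, habs]
  · rw [hfd, hfd2]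
    refine le_trans (ContinuousLinearMap.opNorm_smul_le _ _) ?_
    rw [Real.norm_eq_abs, habs]
    exact le_trans (mul_le_of_le_one_right (by positivity) hn) h2

/-- A nonnegative function with second order Taylor remainder at `x` controlled by `M` has a
gradient at `x` controlled by the square root of its value. -/
theorem norm_sq_le_of_taylor_nonneg {c M : ℝ} {L : E →L[ℝ] ℝ} (hc : 0 ≤ c) (hM : 0 ≤ M)
    (h : ∀ v : E, 0 ≤ c + L v + M * ‖v‖ ^ 2) : ‖L‖ ^ 2 ≤ 4 * M * c := by
  have key : ‖L‖ ≤ √(4 * M * c) := by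
    refine L.opNorm_le_bound (Real.sqrt_nonneg _) fun v => ?_
    have hd := discrim_le_zero (a := M * ‖v‖ ^ 2) (b := L v) (c := c) fun t => by
      have := h (t • v)
      rw [map_smul, norm_smul, mul_pow, Real.norm_eq_abs, sq_abs, smul_eq_mul] at this
      nlinarith
    rw [discrim] at hd
    rw [Real.norm_eq_abs]
    refine abs_le_of_sq_le_sq ?_ (by positivity)
    rw [mul_pow, Real.sq_sqrt (by positivity)]
    linarith
  calc ‖L‖ ^ 2 ≤ √(4 * M * c) ^ 2 := by gcongr
    _ = _ := Real.sq_sqrt (by positivity)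

/-- First order Taylor estimates for a `C²` function with bounded second derivative. -/
theorem norm_fderiv_sub_le {F : E → ℝ} {M : ℝ} (hF : ContDiff ℝ 2 F)
    (h : ∀ x, ‖iteratedFDeriv ℝ 2 F x‖ ≤ M) (x y : E) :
    ‖fderiv ℝ F y - fderiv ℝ F x‖ ≤ M * ‖y - x‖ := by
  refine convex_univ.norm_image_sub_le_of_norm_fderiv_le (𝕜 := ℝ) (fun z _ => ?_) (fun z _ => ?_)
    (Set.mem_univ x) (Set.mem_univ y)
  · exact (hF.fderiv_right (m := 1) (by norm_num)).differentiable (by norm_num) z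
  · rw [← norm_iteratedFDeriv_two]; exact h z

theorem abs_taylor_sub_le {F : E → ℝ} {M : ℝ} (hM : 0 ≤ M) (hF : ContDiff ℝ 2 F)
    (h : ∀ x, ‖iteratedFDeriv ℝ 2 F x‖ ≤ M) (x y : E) :
    |F y - F x - fderiv ℝ F x (y - x)| ≤ M * ‖y - x‖ ^ 2 := by
  have hd : Differentiable ℝ F := hF.differentiable (by norm_num)
  have := (convex_closedBall x ‖y - x‖).norm_image_sub_le_of_norm_hasFDerivWithin_le' (𝕜 := ℝ)
    (f := F) (f' := fderiv ℝ F) (φ := fderiv ℝ F x) (C := M * ‖y - x‖) (x := x) (y := y)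
    (fun z _ => (hd z).hasFDerivAt.hasFDerivWithinAt)
    (fun z hz => (norm_fderiv_sub_le hF h x z).trans (by
      have : ‖z - x‖ ≤ ‖y - x‖ := by simpa [dist_eq_norm] using hz
      gcongr))
    (by simp) (by simp [dist_eq_norm])
  rw [Real.norm_eq_abs] at this
  linarith [this, sq ‖y - x‖, mul_assoc M ‖y - x‖ ‖y - x‖]

theorem sq_norm_fderiv_le_of_nonneg {F : E → ℝ} {M : ℝ} (hM : 0 ≤ M) (hF : ContDiff ℝ 2 F)
    (h : ∀ x, ‖iteratedFDeriv ℝ 2 F x‖ ≤ M) (hn : ∀ x, 0 ≤ F x) (x : E) :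
    ‖fderiv ℝ F x‖ ^ 2 ≤ 4 * M * F x := by
  refine norm_sq_le_of_taylor_nonneg (hn x) hM fun v => ?_
  have h1 := abs_taylor_sub_le hM hF h x (x + v)
  rw [add_sub_cancel_left, abs_le] at h1
  linarith [hn (x + v), h1.2]

end JetBounds

section InverseDistanceWeights

variable {E : Type*} [NormedAddCommGroup E]

/-- The product of the squared distances to the points of `T`. -/
noncomputable def sqDistProd (T : Finset E) (y : E) : ℝ := ∏ z ∈ T, ‖y - z‖ ^ 2

/-- The common denominator of the inverse distance weights. -/
noncomputable def weightDenom (S : Finset E) (y : E) : ℝ :=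
  sqDistProd S y + ∑ x ∈ S, sqDistProd (S.erase x) y

/-- The weight proportional to `‖y - x‖⁻²`, normalized against the weights of the other points
of `S` and a weight `1` attached to infinity. -/
noncomputable def pointWeight (S : Finset E) (x y : E) : ℝ :=
  sqDistProd (S.erase x) y * (weightDenom S y)⁻¹

/-- The weight attached to infinity. -/
noncomputable def inftyWeight (S : Finset E) (y : E) : ℝ :=
  sqDistProd S y * (weightDenom S y)⁻¹

theorem sqDistProd_nonneg (T : Finset E) (y : E) : 0 ≤ sqDistProd T y :=
  Finset.prod_nonneg fun _ _ => by positivity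

theorem sqDistProd_pos {T : Finset E} {y : E} (hy : y ∉ T) : 0 < sqDistProd T y := by
  refine Finset.prod_pos fun z hz => ?_
  have : y - z ≠ 0 := sub_ne_zero.2 (by rintro rfl; exact hy hz)
  positivity

theorem sqDistProd_eq_zero {T : Finset E} {y : E} (hy : y ∈ T) : sqDistProd T y = 0 :=
  Finset.prod_eq_zero hy (by simp)

theorem sqDistProd_erase_mul {S : Finset E} {x : E} (hx : x ∈ S) (y : E) :
    sqDistProd (S.erase x) y * ‖y - x‖ ^ 2 = sqDistProd S y :=
  Finset.prod_erase_mul S _ hx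

theorem weightDenom_pos (S : Finset E) (y : E) : 0 < weightDenom S y := by
  by_cases hy : y ∈ S
  · refine add_pos_of_nonneg_of_pos (sqDistProd_nonneg _ _) ?_
    exact Finset.sum_pos' (fun x _ => sqDistProd_nonneg _ _)
      ⟨y, hy, sqDistProd_pos (Finset.notMem_erase y S)⟩
  · exact add_pos_of_pos_of_nonneg (sqDistProd_pos hy)
      (Finset.sum_nonneg fun x _ => sqDistProd_nonneg _ _)

theorem pointWeight_nonneg (S : Finset E) (x y : E) : 0 ≤ pointWeight S x y :=
  mul_nonneg (sqDistProd_nonneg _ _) (inv_nonneg.2 (weightDenom_pos S y).le)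

theorem inftyWeight_nonneg (S : Finset E) (y : E) : 0 ≤ inftyWeight S y :=
  mul_nonneg (sqDistProd_nonneg _ _) (inv_nonneg.2 (weightDenom_pos S y).le)

theorem inftyWeight_add_sum (S : Finset E) (y : E) :
    inftyWeight S y + ∑ x ∈ S, pointWeight S x y = 1 := by
  simp only [inftyWeight, pointWeight]
  rw [← Finset.sum_mul, ← add_mul]
  exact mul_inv_cancel₀ (weightDenom_pos S y).ne'

theorem pointWeight_le_one {S : Finset E} {x : E} (hx : x ∈ S) (y : E) :
    pointWeight S x y ≤ 1 := by
  have h1 := Finset.single_le_sum (f := fun x => pointWeight S x y)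
    (fun x _ => pointWeight_nonneg S x y) hx
  linarith [inftyWeight_add_sum S y, inftyWeight_nonneg S y]

theorem inftyWeight_le_one (S : Finset E) (y : E) : inftyWeight S y ≤ 1 := by
  have h1 : 0 ≤ ∑ x ∈ S, pointWeight S x y :=
    Finset.sum_nonneg fun x _ => pointWeight_nonneg S x y
  linarith [inftyWeight_add_sum S y]

theorem pointWeight_mul_sq {S : Finset E} {x : E} (hx : x ∈ S) (y : E) :
    pointWeight S x y * ‖y - x‖ ^ 2 = inftyWeight S y := by
  rw [inftyWeight, ← sqDistProd_erase_mul hx, pointWeight]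
  ring

theorem pointWeight_eq_zero {S : Finset E} {x y : E} (hy : y ∈ S) (hxy : y ≠ x) :
    pointWeight S x y = 0 := by
  rw [pointWeight, sqDistProd_eq_zero (Finset.mem_erase.2 ⟨hxy, hy⟩), zero_mul]

theorem pointWeight_self {S : Finset E} {x : E} (hx : x ∈ S) : pointWeight S x x = 1 := by
  have h := inftyWeight_add_sum S x
  rwa [inftyWeight, sqDistProd_eq_zero hx, zero_mul, zero_add, Finset.sum_eq_single_of_mem x hx
    fun z _ hz => pointWeight_eq_zero hx hz.symm] at h

variable [InnerProductSpace ℝ E] {N : ℕ} {r : ℝ} {y : E}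

theorem jetBound_sqDistProd {T : Finset E} (hN : T.card ≤ N) (hr : 0 ≤ r)
    (h : ∀ z ∈ T, 1 ≤ r * ‖y - z‖) :
    JetBound (sqDistProd T) y (8 ^ N * sqDistProd T y) r := by
  have key : ∀ z ∈ T, JetBound (fun w => ‖w - z‖ ^ 2) y (2 * ‖y - z‖ ^ 2) r := by
    intro z hz
    have hz' := h z hz
    have hn := norm_nonneg (y - z)
    have := jetBound_quadratic 0 1 (0 : E →L[ℝ] ℝ) z y (B := 2 * ‖y - z‖ ^ 2) (r := r)
      (by simp only [zero_apply, zero_add, one_mul]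
          rw [abs_of_nonneg (by positivity)]; nlinarith)
      (by simp only [norm_zero, abs_one]; nlinarith)
      (by simp only [abs_one]; nlinarith)
    simpa using this
  have h2 := JetBound.prod hr key
  refine JetBound.mono h2 ?_ hr
  have := sqDistProd_nonneg T y
  change (4 * 2) ^ T.card * sqDistProd T y ≤ _
  norm_num only
  gcongr
  norm_num

theorem jetBound_weightDenom_inv {S : Finset E} (hN : S.card ≤ N) (hr : 0 ≤ r)
    (h : ∀ z ∈ S, 1 ≤ r * ‖y - z‖) :
    JetBound (fun z => (weightDenom S z)⁻¹) y (3 * (8 ^ N) ^ 2 * (weightDenom S y)⁻¹) r := by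
  refine JetBound.inv (one_le_pow₀ (by norm_num)) hr (weightDenom_pos S) ?_
  have h1 := (jetBound_sqDistProd hN hr h).add (JetBound.sum hr (s := S) fun x _ =>
    jetBound_sqDistProd (T := S.erase x) ((Finset.card_erase_le).trans hN) hr
      fun z hz => h z (Finset.mem_of_mem_erase hz))
  rw [← Finset.mul_sum, ← mul_add] at h1
  exact h1

theorem jetBound_sqDistProd_mul_inv {S T : Finset E} (hTS : T ⊆ S) (hN : S.card ≤ N)
    (hr : 0 ≤ r) (h : ∀ z ∈ S, 1 ≤ r * ‖y - z‖) :
    JetBound (fun z => sqDistProd T z * (weightDenom S z)⁻¹) y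
      (12 * 512 ^ N * (sqDistProd T y * (weightDenom S y)⁻¹)) r := by
  have h1 := (jetBound_sqDistProd ((Finset.card_le_card hTS).trans hN) hr
    fun z hz => h z (hTS hz)).mul (jetBound_weightDenom_inv hN hr h)
  convert h1 using 1
  rw [show (512 : ℝ) = 8 ^ 3 by norm_num, ← pow_mul]
  ring

theorem jetBound_pointWeight {S : Finset E} (hN : S.card ≤ N) (hr : 0 ≤ r)
    (h : ∀ z ∈ S, 1 ≤ r * ‖y - z‖) (x : E) :
    JetBound (pointWeight S x) y (12 * 512 ^ N * pointWeight S x y) r :=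
  jetBound_sqDistProd_mul_inv (Finset.erase_subset x S) hN hr h

theorem jetBound_inftyWeight {S : Finset E} (hN : S.card ≤ N) (hr : 0 ≤ r)
    (h : ∀ z ∈ S, 1 ≤ r * ‖y - z‖) :
    JetBound (inftyWeight S) y (12 * 512 ^ N * inftyWeight S y) r :=
  jetBound_sqDistProd_mul_inv subset_rfl hN hr h

theorem contDiff_pointWeight (S : Finset E) (x : E) : ContDiff ℝ 2 (pointWeight S x) := by
  have h : ∀ T : Finset E, ContDiff ℝ 2 (sqDistProd T) := fun T =>
    contDiff_prod fun z _ => (contDiff_id.sub contDiff_const).norm_sq ℝ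
  exact (h _).mul (((h S).add (ContDiff.sum fun z _ => h _)).inv
    fun z => (weightDenom_pos S z).ne')

end InverseDistanceWeights

section Extension

variable {E : Type*} [NormedAddCommGroup E] [InnerProductSpace ℝ E]

/-- The affine jet `f x + g x (y - x)` corrected by a multiple of the squared distance. -/
noncomputable def liftedJet (f : E → ℝ) (g : E → E →L[ℝ] ℝ) (A : ℝ) (x y : E) : ℝ :=
  f x + g x (y - x) + A * ‖y - x‖ ^ 2

/-- The weighted average of the lifted jets at the points of `S`. -/
noncomputable def blendedJets (S : Finset E) (f : E → ℝ) (g : E → E →L[ℝ] ℝ) (A : ℝ) (y : E) :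
    ℝ :=
  ∑ x ∈ S, pointWeight S x y * liftedJet f g A x y

/-- A Whitney field on `S` with all size and compatibility constants at most `A`, including the
one expressing compatibility with nonnegativity. -/
structure IsPosWhitneyField (S : Finset E) (f : E → ℝ) (g : E → E →L[ℝ] ℝ) (A : ℝ) : Prop where
  value_nonneg : ∀ x ∈ S, 0 ≤ f x
  value_le : ∀ x ∈ S, f x ≤ A
  norm_le : ∀ x ∈ S, ‖g x‖ ≤ A
  norm_sq_le : ∀ x ∈ S, ‖g x‖ ^ 2 ≤ A * f x
  value_sub_le : ∀ x ∈ S, ∀ y ∈ S, |f x - f y - g y (x - y)| ≤ A * ‖x - y‖ ^ 2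
  norm_jet_sub_le : ∀ x ∈ S, ∀ y ∈ S, ‖g x - g y‖ ≤ A * ‖x - y‖

namespace IsPosWhitneyField

variable {S : Finset E} {f : E → ℝ} {g : E → E →L[ℝ] ℝ} {A : ℝ} {x y : E}

theorem const_nonneg (h : IsPosWhitneyField S f g A) (hx : x ∈ S) : 0 ≤ A :=
  (norm_nonneg _).trans (h.norm_le x hx)

theorem liftedJet_nonneg (h : IsPosWhitneyField S f g A) (hx : x ∈ S) (y : E) :
    0 ≤ liftedJet f g A x y := by
  have hA := h.const_nonneg hx
  have hf := h.value_nonneg x hx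
  have hg : (g x (y - x)) ^ 2 ≤ A * f x * ‖y - x‖ ^ 2 := by
    calc (g x (y - x)) ^ 2 = ‖g x (y - x)‖ ^ 2 := by rw [Real.norm_eq_abs, sq_abs]
      _ ≤ (‖g x‖ * ‖y - x‖) ^ 2 := by gcongr; exact (g x).le_opNorm _
      _ = ‖g x‖ ^ 2 * ‖y - x‖ ^ 2 := by ring
      _ ≤ _ := by gcongr; exact h.norm_sq_le x hx
  have hs : |g x (y - x)| ≤ f x + A * ‖y - x‖ ^ 2 := by
    refine abs_le_of_sq_le_sq ?_ (by positivity)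
    nlinarith [sq_nonneg (f x - A * ‖y - x‖ ^ 2), mul_nonneg hf (mul_nonneg hA (sq_nonneg ‖y - x‖))]
  rw [liftedJet]
  linarith [(abs_le.1 hs).1]

theorem liftedJet_le (h : IsPosWhitneyField S f g A) (hx : x ∈ S) (y : E) :
    liftedJet f g A x y ≤ A + A * ‖y - x‖ + A * ‖y - x‖ ^ 2 := by
  have h1 : g x (y - x) ≤ A * ‖y - x‖ :=
    (le_abs_self _).trans ((g x).le_of_opNorm_le (h.norm_le x hx) _)
  rw [liftedJet]
  linarith [h.value_le x hx]

theorem abs_liftedJet_le (h : IsPosWhitneyField S f g A) (hx : x ∈ S) (y : E) :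
    |liftedJet f g A x y| ≤ A + A * ‖y - x‖ + A * ‖y - x‖ ^ 2 := by
  rw [abs_of_nonneg (h.liftedJet_nonneg hx y)]
  exact h.liftedJet_le hx y

theorem jetBound_liftedJet (h : IsPosWhitneyField S f g A) (hx : x ∈ S) {B r : ℝ}
    (h0 : A + A * ‖y - x‖ + A * ‖y - x‖ ^ 2 ≤ B) (h1 : A + 2 * A * ‖y - x‖ ≤ B * r)
    (h2 : 2 * A ≤ B * r ^ 2) : JetBound (liftedJet f g A x) y B r := by
  have hA := abs_of_nonneg (h.const_nonneg hx)
  refine jetBound_quadratic (f x) A (g x) x y ((h.abs_liftedJet_le hx y).trans h0) ?_ ?_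
  · rw [hA]; linarith [h.norm_le x hx]
  · rwa [hA]

theorem jetBound_liftedJet_sub (h : IsPosWhitneyField S f g A) (hx : x ∈ S) {x₀ : E}
    (hx₀ : x₀ ∈ S) {r : ℝ} (hr : 1 ≤ r * ‖y - x‖) (hd : ‖x - x₀‖ ≤ 2 * ‖y - x‖) :
    JetBound (fun z => liftedJet f g A x z - liftedJet f g A x₀ z) y (14 * A * ‖y - x‖ ^ 2) r := by
  have hA := h.const_nonneg hx
  set c := f x - f x₀ - g x₀ (x - x₀) - A * ‖x - x₀‖ ^ 2 with hc
  set l : E →L[ℝ] ℝ := g x - g x₀ - (2 * A) • innerSL ℝ (x - x₀) with hl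
  have heq : (fun z => liftedJet f g A x z - liftedJet f g A x₀ z) =
      fun z => c + l (z - x) + 0 * ‖z - x‖ ^ 2 := by
    funext z
    have hz : z - x₀ = (z - x) + (x - x₀) := by abel
    simp only [liftedJet, hc, hl, hz, norm_add_sq_real, map_add, sub_apply,
      smul_apply, innerSL_apply_apply, smul_eq_mul,
      real_inner_comm (x - x₀) (z - x)]
    ring
  have hc' : |c| ≤ 8 * A * ‖y - x‖ ^ 2 := by
    have h1 := abs_le.1 (h.value_sub_le x hx x₀ hx₀)
    have h2 : A * ‖x - x₀‖ ^ 2 ≤ A * (2 * ‖y - x‖) ^ 2 := by gcongr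
    have h3 : 0 ≤ A * ‖x - x₀‖ ^ 2 := by positivity
    rw [abs_le]
    constructor <;> linarith [h1.1, h1.2]
  have hl' : ‖l‖ ≤ 6 * A * ‖y - x‖ := by
    calc ‖l‖ ≤ ‖g x - g x₀‖ + ‖(2 * A) • innerSL ℝ (x - x₀)‖ := norm_sub_le _ _
      _ ≤ A * ‖x - x₀‖ + 2 * A * ‖x - x₀‖ := by
        rw [norm_smul, innerSL_apply_norm, Real.norm_eq_abs, abs_of_nonneg (by positivity)]
        gcongr
        exact h.norm_jet_sub_le x hx x₀ hx₀
      _ = 3 * A * ‖x - x₀‖ := by ring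
      _ ≤ 3 * A * (2 * ‖y - x‖) := by gcongr
      _ = _ := by ring
  have hv := norm_nonneg (y - x)
  rw [heq]
  refine jetBound_quadratic c 0 l x y ?_ ?_ ?_
  · rw [zero_mul, add_zero]
    calc _ ≤ |c| + |l (y - x)| := abs_add_le _ _
      _ ≤ 8 * A * ‖y - x‖ ^ 2 + 6 * A * ‖y - x‖ * ‖y - x‖ :=
        add_le_add hc' (l.le_of_opNorm_le hl' _)
      _ = _ := by ring
  · rw [abs_zero, mul_zero, zero_mul, add_zero]
    have : A * ‖y - x‖ * 1 ≤ A * ‖y - x‖ * (r * ‖y - x‖) := by gcongr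
    have h5 : 0 ≤ A * ‖y - x‖ := by positivity
    nlinarith
  · rw [abs_zero, mul_zero]; positivity

theorem blendedJets_nonneg (h : IsPosWhitneyField S f g A) (y : E) :
    0 ≤ blendedJets S f g A y :=
  Finset.sum_nonneg fun x hx => mul_nonneg (pointWeight_nonneg S x y) (h.liftedJet_nonneg hx y)

theorem blendedJets_le (h : IsPosWhitneyField S f g A) (y : E) :
    blendedJets S f g A y ≤ S.card * (4 * A) := by
  rw [← nsmul_eq_mul]
  refine Finset.sum_le_card_nsmul _ _ _ fun x hx => ?_
  have hA := h.const_nonneg hx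
  have hw := pointWeight_nonneg S x y
  have h1 : liftedJet f g A x y ≤ 2 * A * (1 + ‖y - x‖ ^ 2) := by
    nlinarith [h.liftedJet_le hx y, mul_nonneg hA (sq_nonneg (‖y - x‖ - 1))]
  calc _ ≤ pointWeight S x y * (2 * A * (1 + ‖y - x‖ ^ 2)) := by gcongr
    _ = 2 * A * (pointWeight S x y + pointWeight S x y * ‖y - x‖ ^ 2) := by ring
    _ ≤ 2 * A * (1 + 1) := by
      rw [pointWeight_mul_sq hx]
      gcongr
      · exact pointWeight_le_one hx y
      · exact inftyWeight_le_one S y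
    _ = 4 * A := by ring

end IsPosWhitneyField

theorem blendedJets_apply_of_mem {S : Finset E} {f : E → ℝ} {g : E → E →L[ℝ] ℝ} {A : ℝ} {x : E}
    (hx : x ∈ S) : blendedJets S f g A x = f x := by
  rw [blendedJets, Finset.sum_eq_single_of_mem x hx fun z _ hz => by
    rw [pointWeight_eq_zero hx hz.symm, zero_mul], pointWeight_self hx]
  simp [liftedJet]

theorem contDiff_liftedJet (f : E → ℝ) (g : E → E →L[ℝ] ℝ) (A : ℝ) (x : E) :
    ContDiff ℝ 2 (liftedJet f g A x) :=
  (contDiff_const.add ((g x).contDiff.comp (contDiff_id.sub contDiff_const))).add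
    (contDiff_const.mul ((contDiff_id.sub contDiff_const).norm_sq ℝ))

theorem contDiff_blendedJets (S : Finset E) (f : E → ℝ) (g : E → E →L[ℝ] ℝ) (A : ℝ) :
    ContDiff ℝ 2 (blendedJets S f g A) :=
  ContDiff.sum fun x _ => (contDiff_pointWeight S x).mul (contDiff_liftedJet f g A x)

namespace IsPosWhitneyField

variable {S : Finset E} {f : E → ℝ} {g : E → E →L[ℝ] ℝ} {A : ℝ} {y : E} {N : ℕ}

theorem norm_hessian_le_of_far (h : IsPosWhitneyField S f g A) (hN : S.card ≤ N)
    (hA : 0 ≤ A) (hy : ∀ x ∈ S, 1 ≤ ‖y - x‖) :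
    ‖iteratedFDeriv ℝ 2 (blendedJets S f g A) y‖ ≤ N * (144 * 512 ^ N * A) := by
  have hj : JetBound (blendedJets S f g A) y (∑ _x ∈ S, 144 * 512 ^ N * A) 1 := by
    refine JetBound.sum zero_le_one fun x hx => ?_
    have hv := hy x hx
    have h1 : A ≤ A * ‖y - x‖ := le_mul_of_one_le_right hA hv
    have h2 : A * ‖y - x‖ ≤ A * ‖y - x‖ ^ 2 := by
      gcongr; exact le_self_pow₀ hv two_ne_zero
    have hl : JetBound (liftedJet f g A x) y (3 * A * ‖y - x‖ ^ 2) 1 :=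
      h.jetBound_liftedJet hx (by linarith) (by linarith) (by linarith)
    refine ((jetBound_pointWeight hN zero_le_one (by simpa using hy) x).mul hl).mono ?_ zero_le_one
    calc _ = 144 * 512 ^ N * A * (pointWeight S x y * ‖y - x‖ ^ 2) := by ring
      _ ≤ 144 * 512 ^ N * A * 1 := by
        rw [pointWeight_mul_sq hx]
        gcongr
        exact inftyWeight_le_one S y
      _ = _ := by ring
  refine (hj.2 2 le_rfl).trans ?_
  rw [Finset.sum_const, nsmul_eq_mul, one_pow, mul_one]
  gcongr

theorem norm_hessian_le_of_near (h : IsPosWhitneyField S f g A) (hN : S.card ≤ N)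
    {x₀ : E} (hx₀ : x₀ ∈ S) (hy : y ≠ x₀) (hmin : ∀ x ∈ S, ‖y - x₀‖ ≤ ‖y - x‖)
    (hd : ‖y - x₀‖ ≤ 1) :
    ‖iteratedFDeriv ℝ 2 (blendedJets S f g A) y‖ ≤
      N * (672 * 512 ^ N * A) + 144 * 512 ^ N * A + 3 * A := by
  have hA := h.const_nonneg hx₀
  set d := ‖y - x₀‖ with hd_def
  have hd0 : 0 < d := norm_pos_iff.2 (sub_ne_zero.2 hy)
  have hr0 : 0 ≤ d⁻¹ := by positivity
  have hr : ∀ x ∈ S, 1 ≤ d⁻¹ * ‖y - x‖ := fun x hx => by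
    rw [inv_mul_eq_div, one_le_div hd0]; exact hmin x hx
  have hinf : inftyWeight S y ≤ d ^ 2 := by
    rw [← pointWeight_mul_sq hx₀]
    exact mul_le_of_le_one_left (by positivity) (pointWeight_le_one hx₀ y)
  set G : E → ℝ := fun z =>
    (∑ x ∈ S, pointWeight S x z * (liftedJet f g A x z - liftedJet f g A x₀ z)) +
      -(inftyWeight S z * liftedJet f g A x₀ z) with hG_def
  have hFG : blendedJets S f g A = liftedJet f g A x₀ + G := by
    funext z
    simp only [hG_def, Pi.add_apply, mul_sub, Finset.sum_sub_distrib, ← Finset.sum_mul]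
    rw [blendedJets]
    linear_combination liftedJet f g A x₀ z * inftyWeight_add_sum S z
  have hd2 : A * d ^ 2 ≤ A := mul_le_of_le_one_right hA (pow_le_one₀ hd0.le hd)
  have hd1 : A * d ≤ A := mul_le_of_le_one_right hA hd
  have hr1 : 1 ≤ d⁻¹ := (one_le_inv₀ hd0).2 hd
  have hQ : JetBound (liftedJet f g A x₀) y (3 * A) 1 :=
    h.jetBound_liftedJet hx₀ (by linarith) (by linarith) (by linarith)
  have hQr : JetBound (liftedJet f g A x₀) y (3 * A) d⁻¹ :=
    ⟨hQ.1, fun i hi => (hQ.2 i hi).trans (by gcongr)⟩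
  have hG : JetBound G y ((∑ _x ∈ S, 672 * 512 ^ N * A * d ^ 2) + 144 * 512 ^ N * A * d ^ 2)
      d⁻¹ := by
    refine (JetBound.sum hr0 fun x hx => ?_).add (JetBound.neg ?_)
    · have hx2 : ‖x - x₀‖ ≤ 2 * ‖y - x‖ := by
        have h1 : x - x₀ = (y - x₀) - (y - x) := by abel
        rw [h1]
        linarith [norm_sub_le (y - x₀) (y - x), hmin x hx]
      refine ((jetBound_pointWeight hN hr0 hr x).mul
        (h.jetBound_liftedJet_sub hx hx₀ (hr x hx) hx2)).mono ?_ hr0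
      calc _ = 672 * 512 ^ N * A * (pointWeight S x y * ‖y - x‖ ^ 2) := by ring
        _ ≤ _ := by rw [pointWeight_mul_sq hx]; gcongr
    · refine ((jetBound_inftyWeight hN hr0 hr).mul hQr).mono ?_ hr0
      calc _ = 144 * 512 ^ N * A * inftyWeight S y := by ring
        _ ≤ _ := by gcongr
  rw [hFG, iteratedFDeriv_add_apply hQ.1.contDiffAt hG.1.contDiffAt]
  refine (norm_add_le _ _).trans ?_
  have e1 : ‖iteratedFDeriv ℝ 2 (liftedJet f g A x₀) y‖ ≤ 3 * A := by
    simpa using hQ.2 2 le_rfl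
  have e2 : ‖iteratedFDeriv ℝ 2 G y‖ ≤ N * (672 * 512 ^ N * A) + 144 * 512 ^ N * A := by
    refine (hG.2 2 le_rfl).trans ?_
    have hdd : d ^ 2 * d⁻¹ ^ 2 = 1 := by rw [← mul_pow, mul_inv_cancel₀ hd0.ne', one_pow]
    rw [Finset.sum_const, nsmul_eq_mul]
    calc _ = (S.card * (672 * 512 ^ N * A) + 144 * 512 ^ N * A) * (d ^ 2 * d⁻¹ ^ 2) := by ring
      _ = S.card * (672 * 512 ^ N * A) + 144 * 512 ^ N * A := by rw [hdd, mul_one]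
      _ ≤ _ := by gcongr
  linarith

theorem norm_hessian_le [Nontrivial E] (h : IsPosWhitneyField S f g A) (hS : S.Nonempty)
    (hN : S.card ≤ N) (y : E) :
    ‖iteratedFDeriv ℝ 2 (blendedJets S f g A) y‖ ≤ (672 * N + 147) * 512 ^ N * A := by
  obtain ⟨a, ha⟩ := hS
  have hA := h.const_nonneg ha
  have hclosed : IsClosed {y | ‖iteratedFDeriv ℝ 2 (blendedJets S f g A) y‖ ≤
      (672 * N + 147) * 512 ^ N * A} :=
    isClosed_le ((contDiff_blendedJets S f g A).continuous_iteratedFDeriv le_rfl).norm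
      continuous_const
  have hdense : Dense ((S : Set E)ᶜ) := S.finite_toSet.countable.dense_compl ℝ
  refine hclosed.closure_subset_iff.2 (fun z hz => ?_) (hdense y)
  have hz' : z ∉ S := by simpa using hz
  obtain ⟨x₀, hx₀, hmin⟩ := S.exists_min_image (fun x => ‖z - x‖) ⟨a, ha⟩
  have hP : A ≤ 512 ^ N * A := le_mul_of_one_le_left hA (one_le_pow₀ (by norm_num))
  have hNA : 0 ≤ N * (512 ^ N * A) := by positivity
  simp only [Set.mem_ofPred_eq]
  rcases le_total 1 ‖z - x₀‖ with hd | hd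
  · refine (h.norm_hessian_le_of_far hN hA fun x hx => hd.trans (hmin x hx)).trans ?_
    nlinarith
  · refine (h.norm_hessian_le_of_near hN hx₀ (by rintro rfl; exact hz' hx₀) hmin hd).trans ?_
    nlinarith

theorem exists_nonneg_extension [Nontrivial E] (h : IsPosWhitneyField S f g A)
    (hA : 0 ≤ A) (hN : S.card ≤ N) :
    ∃ F : E → ℝ, (∀ y, 0 ≤ F y) ∧ (∀ x ∈ S, F x = f x) ∧ ContDiff ℝ 2 F ∧
      ∀ y : E, ∀ i : ℕ, i ≤ 2 →
        ‖iteratedFDeriv ℝ i F y‖ ≤ 2 * ((676 * N + 147) * 512 ^ N) * A := by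
  rcases S.eq_empty_or_nonempty with rfl | hS
  · refine ⟨fun _ => 0, fun _ => le_rfl, by simp, contDiff_const, fun y i hi => ?_⟩
    have h0 := (JetBound.const (E := E) (y := y) 0 zero_le_one).2 i hi
    rw [abs_zero, zero_mul] at h0
    exact h0.trans (by positivity)
  set M := (676 * N + 147) * 512 ^ N * A with hM
  have hP : A ≤ 512 ^ N * A := le_mul_of_one_le_left hA (one_le_pow₀ (by norm_num))
  have hNA : 0 ≤ N * (512 ^ N * A) := by positivity
  have hM0 : 0 ≤ M := by positivity
  have hc := contDiff_blendedJets S f g A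
  have hn := h.blendedJets_nonneg
  have h2 : ∀ y, ‖iteratedFDeriv ℝ 2 (blendedJets S f g A) y‖ ≤ M := fun y =>
    (h.norm_hessian_le hS hN y).trans (by rw [hM]; gcongr; norm_num)
  have h0 : ∀ y, blendedJets S f g A y ≤ M := fun y => by
    have h1 : (S.card : ℝ) * (4 * A) ≤ N * (4 * (512 ^ N * A)) := by gcongr
    refine (h.blendedJets_le y).trans (h1.trans ?_)
    rw [hM]
    nlinarith
  refine ⟨blendedJets S f g A, hn, fun x hx => blendedJets_apply_of_mem hx, hc,
    fun y i hi => ?_⟩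
  have hM2 : 2 * ((676 * N + 147) * 512 ^ N) * A = 2 * M := by rw [hM]; ring
  rw [hM2]
  interval_cases i
  · rw [norm_iteratedFDeriv_zero, Real.norm_eq_abs, abs_of_nonneg (hn y)]
    linarith [h0 y]
  · rw [norm_iteratedFDeriv_one]
    refine le_of_sq_le_sq ?_ (by positivity)
    calc _ ≤ 4 * M * blendedJets S f g A y := sq_norm_fderiv_le_of_nonneg hM0 hc h2 hn y
      _ ≤ 4 * M * M := by gcongr; exact h0 y
      _ = _ := by ring
  · linarith [h2 y]

end IsPosWhitneyField

end Extension

theorem evalA_eq_add (P Q : AffPoly) (x y : E2) :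
    evalA P x - evalA Q x = evalA P x - evalA Q y - Q.2 (x - y) := by
  simp only [evalA, map_sub]
  ring

theorem abs_evalA_add_norm_le_QS {S : Finset E2} (P : E2 → AffPoly) {x : E2} (hx : x ∈ S) :
    |evalA (P x) x| + ‖(P x).2‖ ≤ QS S P := by
  refine (Finset.single_le_sum (f := fun x => |evalA (P x) x| + ‖(P x).2‖)
    (fun z _ => by positivity) hx).trans (le_add_of_nonneg_right ?_)
  refine Finset.sum_nonneg fun a _ => Finset.sum_nonneg fun b _ => ?_
  split_ifs <;> positivity

theorem sub_terms_le_QS {S : Finset E2} (P : E2 → AffPoly) {x y : E2} (hx : x ∈ S) (hy : y ∈ S)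
    (hxy : x ≠ y) :
    |evalA (P x) x - evalA (P y) x| / dist x y ^ 2 + ‖(P x).2 - (P y).2‖ / dist x y ≤
      QS S P := by
  have hnn : ∀ a b : E2, 0 ≤ if a = b then 0 else
      (|evalA (P a) a - evalA (P b) a| / dist a b ^ 2 + ‖(P a).2 - (P b).2‖ / dist a b) := by
    intro a b
    split_ifs <;> positivity
  have h1 := Finset.single_le_sum (f := fun b => if x = b then 0 else
    (|evalA (P x) x - evalA (P b) x| / dist x b ^ 2 + ‖(P x).2 - (P b).2‖ / dist x b))
    (fun b _ => hnn x b) hy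
  have h2 := Finset.single_le_sum (f := fun a => ∑ b ∈ S, if a = b then 0 else
    (|evalA (P a) a - evalA (P b) a| / dist a b ^ 2 + ‖(P a).2 - (P b).2‖ / dist a b))
    (fun a _ => Finset.sum_nonneg fun b _ => hnn a b) hx
  have h3 : 0 ≤ ∑ x ∈ S, (|evalA (P x) x| + ‖(P x).2‖) :=
    Finset.sum_nonneg fun _ _ => by positivity
  simp only [if_neg hxy] at h1
  rw [QS]
  linarith

theorem QS_nonneg (S : Finset E2) (P : E2 → AffPoly) : 0 ≤ QS S P := by
  refine add_nonneg (Finset.sum_nonneg fun _ _ => by positivity)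
    (Finset.sum_nonneg fun a _ => Finset.sum_nonneg fun b _ => ?_)
  split_ifs <;> positivity

theorem norm_sq_le_MS_mul {S : Finset E2} {P : E2 → AffPoly} (h : MS S P ≠ ⊤) {x : E2}
    (hx : x ∈ S) (hP : ∀ x ∈ S, 0 ≤ evalA (P x) x) :
    ‖(P x).2‖ ^ 2 ≤ (MS S P).toReal * evalA (P x) x := by
  have h1 : ENNReal.ofReal (‖(P x).2‖ ^ 2) / ENNReal.ofReal (evalA (P x) x) ≤ MS S P := by
    rw [MS, if_pos hP]
    exact Finset.single_le_sum
      (f := fun x => ENNReal.ofReal (‖(P x).2‖ ^ 2) / ENNReal.ofReal (evalA (P x) x))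
      (fun _ _ => zero_le) hx
  rw [ENNReal.div_le_iff_le_mul (Or.inr h) (Or.inl ENNReal.ofReal_ne_top),
    ← ENNReal.ofReal_toReal h, ← ENNReal.ofReal_mul ENNReal.toReal_nonneg] at h1
  exact (ENNReal.ofReal_le_ofReal_iff (mul_nonneg ENNReal.toReal_nonneg (hP x hx))).1 h1

theorem isPosWhitneyField_of_MS_ne_top {S : Finset E2} {f : E2 → ℝ} {P : E2 → AffPoly}
    (hf : ∀ x ∈ S, 0 ≤ f x) (hP : ∀ x ∈ S, evalA (P x) x = f x) (hM : MS S P ≠ ⊤) :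
    IsPosWhitneyField S f (fun x => (P x).2) (QS S P + (MS S P).toReal) := by
  have hm : 0 ≤ (MS S P).toReal := ENNReal.toReal_nonneg
  have hq := QS_nonneg S P
  have hpos : ∀ x ∈ S, 0 ≤ evalA (P x) x := fun x hx => by rw [hP x hx]; exact hf x hx
  refine ⟨hf, fun x hx => ?_, fun x hx => ?_, fun x hx => ?_, fun x hx y hy => ?_,
    fun x hx y hy => ?_⟩
  · have := abs_evalA_add_norm_le_QS P hx
    rw [hP x hx] at this
    linarith [le_abs_self (f x), norm_nonneg (P x).2]
  · have := abs_evalA_add_norm_le_QS P hx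
    linarith [abs_nonneg (evalA (P x) x)]
  · have := norm_sq_le_MS_mul hM hx hpos
    rw [hP x hx] at this
    nlinarith [mul_nonneg hq (hf x hx)]
  · rcases eq_or_ne x y with rfl | hxy
    · simp
    · have h1 := sub_terms_le_QS P hx hy hxy
      have hd : 0 < dist x y := dist_pos.2 hxy
      have h2 : 0 ≤ ‖(P x).2 - (P y).2‖ / dist x y := by positivity
      rw [← hP x hx, ← hP y hy, ← evalA_eq_add, ← dist_eq_norm, ← div_le_iff₀ (by positivity)]
      linarith
  · rcases eq_or_ne x y with rfl | hxy
    · simp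
    · have h1 := sub_terms_le_QS P hx hy hxy
      have hd : 0 < dist x y := dist_pos.2 hxy
      have h2 : 0 ≤ |evalA (P x) x - evalA (P y) x| / dist x y ^ 2 := by positivity
      rw [← dist_eq_norm x y, ← div_le_iff₀ hd]
      linarith

/-- The Whitney field of first order Taylor polynomials of `F`. -/
noncomputable def taylorField (F : E2 → ℝ) (x : E2) : AffPoly :=
  (F x - fderiv ℝ F x x, fderiv ℝ F x)

theorem evalA_taylorField (F : E2 → ℝ) (x y : E2) :
    evalA (taylorField F x) y = F x + fderiv ℝ F x (y - x) := by
  simp only [evalA, taylorField, map_sub]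
  ring

theorem evalA_taylorField_self (F : E2 → ℝ) (x : E2) : evalA (taylorField F x) x = F x := by
  simp [evalA_taylorField]

theorem QS_taylorField_le {F : E2 → ℝ} {M : ℝ} {S : Finset E2} {N : ℕ} (hN : S.card ≤ N)
    (hM : 0 ≤ M) (hF : C2BddBy F M) : QS S (taylorField F) ≤ (2 * N + 2 * N ^ 2) * M := by
  have hF2 : ∀ x, ‖iteratedFDeriv ℝ 2 F x‖ ≤ M := fun x => hF.2 x 2 le_rfl
  have h1 : ∀ x ∈ S, |evalA (taylorField F x) x| + ‖(taylorField F x).2‖ ≤ 2 * M := by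
    intro x _
    have h0 := hF.2 x 0 (by norm_num)
    have h1 := hF.2 x 1 (by norm_num)
    rw [norm_iteratedFDeriv_zero, Real.norm_eq_abs] at h0
    rw [norm_iteratedFDeriv_one] at h1
    rw [evalA_taylorField_self]
    change |F x| + ‖fderiv ℝ F x‖ ≤ _
    linarith
  have h2 : ∀ x ∈ S, ∀ y ∈ S, (if x = y then 0 else
      (|evalA (taylorField F x) x - evalA (taylorField F y) x| / dist x y ^ 2 +
        ‖(taylorField F x).2 - (taylorField F y).2‖ / dist x y)) ≤ 2 * M := by
    intro x _ y _
    split_ifs with hxy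
    · positivity
    · have hd : 0 < dist x y := dist_pos.2 hxy
      have e1 : |evalA (taylorField F x) x - evalA (taylorField F y) x| / dist x y ^ 2 ≤ M := by
        rw [div_le_iff₀ (by positivity), evalA_taylorField_self, evalA_taylorField, dist_eq_norm,
          ← sub_sub]
        exact abs_taylor_sub_le hM hF.1 hF2 y x
      have e2 : ‖(taylorField F x).2 - (taylorField F y).2‖ / dist x y ≤ M := by
        rw [div_le_iff₀ hd, dist_eq_norm x y]
        exact norm_fderiv_sub_le hF.1 hF2 y x
      linarith
  have hNr : (S.card : ℝ) ≤ N := by exact_mod_cast hN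
  calc QS S (taylorField F) ≤ S.card • (2 * M) + S.card • (S.card • (2 * M)) :=
        add_le_add (Finset.sum_le_card_nsmul _ _ _ h1)
          (Finset.sum_le_card_nsmul _ _ _ fun x hx => Finset.sum_le_card_nsmul _ _ _ (h2 x hx))
    _ = S.card * (2 * M) + S.card * (S.card * (2 * M)) := by simp only [nsmul_eq_mul]
    _ ≤ N * (2 * M) + N * (N * (2 * M)) := by gcongr
    _ = _ := by ring

theorem MS_taylorField_le {F : E2 → ℝ} {M : ℝ} {S : Finset E2} {N : ℕ} (hN : S.card ≤ N)
    (hM : 0 ≤ M) (hF : C2BddBy F M) (hn : ∀ y, 0 ≤ F y) :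
    MS S (taylorField F) ≤ ENNReal.ofReal (4 * N * M) := by
  rw [MS, if_pos fun x _ => by rw [evalA_taylorField_self]; exact hn x]
  have h1 : ∀ x ∈ S, ENNReal.ofReal (‖(taylorField F x).2‖ ^ 2) /
      ENNReal.ofReal (evalA (taylorField F x) x) ≤ ENNReal.ofReal (4 * M) := by
    intro x _
    refine ENNReal.div_le_of_le_mul ?_
    rw [evalA_taylorField_self, ← ENNReal.ofReal_mul (by positivity)]
    exact ENNReal.ofReal_le_ofReal
      (sq_norm_fderiv_le_of_nonneg hM hF.1 (fun x => hF.2 x 2 le_rfl) hn x)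
  refine (Finset.sum_le_card_nsmul _ _ _ h1).trans ?_
  rw [← ENNReal.ofReal_nsmul, nsmul_eq_mul]
  refine ENNReal.ofReal_le_ofReal ?_
  have hNr : (S.card : ℝ) ≤ N := by exact_mod_cast hN
  nlinarith

/-- On sets of at most `N₀` points, the nonnegative trace norm
of `f` is comparable to the infimum of `𝒬_S + ℳ_S` over Whitney fields matching
`f`. -/
theorem statement9 :
    ∀ N₀ : ℕ, ∃ C : ℝ, 0 < C ∧
      ∀ (S : Finset E2) (f : E2 → ℝ), S.card ≤ N₀ → (∀ x ∈ S, 0 ≤ f x) →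
        ENNReal.ofReal (C⁻¹ * posTraceNorm (S : Set E2) f) ≤
            (⨅ (P : E2 → AffPoly) (_ : ∀ x ∈ S, evalA (P x) x = f x),
              ENNReal.ofReal (QS S P) + MS S P) ∧
        (⨅ (P : E2 → AffPoly) (_ : ∀ x ∈ S, evalA (P x) x = f x),
            ENNReal.ofReal (QS S P) + MS S P) ≤
          ENNReal.ofReal (C * posTraceNorm (S : Set E2) f) := by
  intro N
  set K : ℝ := 2 * ((676 * N + 147) * 512 ^ N) with hK
  have hK0 : 0 < K := by positivity
  have hC0 : 0 < K + (2 * N ^ 2 + 6 * N : ℝ) := by positivity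
  refine ⟨K + (2 * N ^ 2 + 6 * N), hC0, fun S f hN hf => ?_⟩
  set C : ℝ := K + (2 * N ^ 2 + 6 * N) with hC
  set V : Set ℝ := {M : ℝ | 0 ≤ M ∧ ∃ F : E2 → ℝ,
    (∀ y, 0 ≤ F y) ∧ (∀ x ∈ (S : Set E2), F x = f x) ∧ C2BddBy F M} with hV
  have hnorm : posTraceNorm (S : Set E2) f = sInf V := rfl
  have hbdd : BddBelow V := ⟨0, fun M hM => hM.1⟩
  have hmem : ∀ P : E2 → AffPoly, (∀ x ∈ S, evalA (P x) x = f x) → MS S P ≠ ⊤ →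
      K * (QS S P + (MS S P).toReal) ∈ V := by
    intro P hP hM
    have hA : 0 ≤ QS S P + (MS S P).toReal := add_nonneg (QS_nonneg S P) ENNReal.toReal_nonneg
    obtain ⟨F, hF0, hFf, hFc, hFb⟩ :=
      (isPosWhitneyField_of_MS_ne_top hf hP hM).exists_nonneg_extension hA hN
    exact ⟨by positivity, F, hF0, hFf, hFc, hFb⟩
  rw [hnorm]
  refine ⟨le_iInf₂ fun P hP => ?_, ?_⟩
  · by_cases hM : MS S P = ⊤
    · simp [hM]
    have hA : 0 ≤ QS S P + (MS S P).toReal := add_nonneg (QS_nonneg S P) ENNReal.toReal_nonneg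
    rw [← ENNReal.ofReal_toReal hM, ← ENNReal.ofReal_add (QS_nonneg S P) ENNReal.toReal_nonneg]
    refine ENNReal.ofReal_le_ofReal ?_
    rw [inv_mul_le_iff₀ hC0]
    refine (csInf_le hbdd (hmem P hP hM)).trans ?_
    gcongr
    rw [hC]
    exact le_add_of_nonneg_right (by positivity)
  · have hne : V.Nonempty := by
      refine ⟨_, hmem (fun x => (f x, 0)) (fun x _ => by simp [evalA]) ?_⟩
      rw [MS, if_pos fun x hx => by simpa [evalA] using hf x hx]
      simp
    set I := ⨅ (P : E2 → AffPoly) (_ : ∀ x ∈ S, evalA (P x) x = f x),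
      ENNReal.ofReal (QS S P) + MS S P with hI
    have hle : ∀ M ∈ V, I ≤ ENNReal.ofReal (C * M) := by
      rintro M ⟨hM, F, hF0, hFf, hF⟩
      have hP : ∀ x ∈ S, evalA (taylorField F x) x = f x := fun x hx => by
        rw [evalA_taylorField_self]; exact hFf x hx
      calc I ≤ ENNReal.ofReal (QS S (taylorField F)) + MS S (taylorField F) :=
            iInf₂_le (taylorField F) hP
        _ ≤ ENNReal.ofReal ((2 * N + 2 * N ^ 2) * M) + ENNReal.ofReal (4 * N * M) :=
            add_le_add (ENNReal.ofReal_le_ofReal (QS_taylorField_le hN hM hF))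
              (MS_taylorField_le hN hM hF hF0)
        _ = ENNReal.ofReal ((2 * N + 2 * N ^ 2) * M + 4 * N * M) :=
            (ENNReal.ofReal_add (by positivity) (by positivity)).symm
        _ ≤ _ := ENNReal.ofReal_le_ofReal (by rw [hC]; nlinarith)
    have hItop : I ≠ ⊤ := by
      obtain ⟨M, hM⟩ := hne
      exact ne_top_of_le_ne_top ENNReal.ofReal_ne_top (hle M hM)
    rw [← ENNReal.ofReal_toReal hItop]
    refine ENNReal.ofReal_le_ofReal ?_
    rw [← div_le_iff₀' hC0]
    refine le_csInf hne fun M hM => ?_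
    rw [div_le_iff₀' hC0]
    exact ENNReal.toReal_le_of_le_ofReal (mul_nonneg hC0.le hM.1) (hle M hM)
end
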